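/- arXiv:2012.07052 — 11 statements merged into one kernel-verified Lean document; each statement's English description precedes it below -/
import Mathlib

section
/- Let G be a group, F a normal subgroup of G, and (H i)_{i ∈ ι} a family of subgroups of G, each of which is normal in G and simple as a group, such that F ⊔ (⨆ i, H i) = ⊤. Then there exists a subset J ⊆ ι such that: (a) every element of F commutes with every element of H j for each j ∈ J, and for distinct j, j' ∈ J every element of H j commutes with every element of H j'; (b) F ⊓ (⨆_{j ∈ J} H j) = ⊥, and for each j ∈ J, H j ⊓ (F ⊔ ⨆_{j' ∈ J, j' ≠ j} H j') = ⊥; (c) F ⊔ (⨆_{j ∈ J} H j) = ⊤. (In other words, G is the internal restricted direct sum of F together with a subfamily of the H j.) -/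
namespace Subgroup

theorem exists_mem_biSup_of_mem_biSup_sUnion {G ι : Type*} [Group G] (H : ι → Subgroup G)
    {c : Set (Set ι)} (hc : IsChain (· ⊆ ·) c) (hne : c.Nonempty) {x : G}
    (hx : x ∈ ⨆ j ∈ ⋃₀ c, H j) : ∃ J ∈ c, x ∈ ⨆ j ∈ J, H j := by
  have : Nonempty c := hne.to_subtype
  have hdir : Directed (· ≤ ·) fun J : c => ⨆ j ∈ (J : Set ι), H j := by
    intro J K
    obtain ⟨L, hL, hJL, hKL⟩ := hc.directedOn J J.2 K K.2
    exact ⟨⟨L, hL⟩, biSup_mono fun _ hj => hJL hj, biSup_mono fun _ hj => hKL hj⟩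
  have hle : ⨆ j ∈ ⋃₀ c, H j ≤ ⨆ J : c, ⨆ j ∈ (J : Set ι), H j := by
    refine iSup₂_le fun j hj => ?_
    obtain ⟨J, hJ, hjJ⟩ := hj
    exact le_iSup_of_le ⟨J, hJ⟩ (le_biSup H hjJ)
  obtain ⟨J, hJ⟩ := (mem_iSup_of_directed hdir).1 (hle hx)
  exact ⟨J, J.2, hJ⟩

theorem disjoint_sup_right_of_disjoint_sup_left {G : Type*} [Group G] {A B C : Subgroup G}
    [C.Normal] (hAB : Disjoint A B) (hABC : Disjoint (A ⊔ B) C) : Disjoint A (B ⊔ C) := by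
  refine disjoint_def.2 fun {x} hxA hx => ?_
  obtain ⟨b, hb, c, hc, rfl⟩ := mem_sup_of_normal_right.1 hx
  have hcAB : c ∈ A ⊔ B := by
    simpa using mul_mem (inv_mem (mem_sup_right hb : b ∈ A ⊔ B)) (mem_sup_left hxA)
  obtain rfl := disjoint_def.1 hABC hcAB hc
  exact disjoint_def.1 hAB hxA (by simpa using hb)

theorem disjoint_or_le_of_isSimpleGroup {G : Type*} [Group G] (N K : Subgroup G) [N.Normal]
    [IsSimpleGroup K] : Disjoint N K ∨ K ≤ N :=
  (IsSimpleGroup.eq_bot_or_eq_top_of_normal (N.subgroupOf K) inferInstance).imp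
    subgroupOf_eq_bot.1 subgroupOf_eq_top.1

/-- The members of `H` indexed by `J`, together with `F`, are independent. -/
def IsIndepOver {G ι : Type*} [Group G] (F : Subgroup G) (H : ι → Subgroup G) (J : Set ι) :
    Prop :=
  Disjoint F (⨆ j ∈ J, H j) ∧
    ∀ j ∈ J, Disjoint (H j) (F ⊔ ⨆ j' ∈ J, ⨆ (_ : j' ≠ j), H j')

theorem IsIndepOver.sUnion {G ι : Type*} [Group G] {F : Subgroup G} [F.Normal]
    {H : ι → Subgroup G} {c : Set (Set ι)} (hc : IsChain (· ⊆ ·) c) (hne : c.Nonempty)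
    (h : ∀ J ∈ c, IsIndepOver F H J) : IsIndepOver F H (⋃₀ c) := by
  refine ⟨disjoint_def.2 fun {x} hxF hx => ?_, fun j hj => disjoint_def.2 fun {x} hxj hx => ?_⟩
  · obtain ⟨J, hJ, hxJ⟩ := exists_mem_biSup_of_mem_biSup_sUnion H hc hne hx
    exact disjoint_def.1 (h J hJ).1 hxF hxJ
  · obtain ⟨K, hK, hjK⟩ := hj
    obtain ⟨f, hf, y, hy, rfl⟩ := mem_sup_of_normal_left.1 hx
    obtain ⟨L, hL, hyL⟩ := exists_mem_biSup_of_mem_biSup_sUnion _ hc hne hy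
    obtain ⟨M, hM, hKM, hLM⟩ := hc.directedOn K hK L hL
    have hyM : y ∈ ⨆ j' ∈ M, ⨆ (_ : j' ≠ j), H j' :=
      (biSup_mono fun _ hj' => hLM hj' :
        ⨆ j' ∈ L, ⨆ (_ : j' ≠ j), H j' ≤ ⨆ j' ∈ M, ⨆ (_ : j' ≠ j), H j') hyL
    exact disjoint_def.1 ((h M hM).2 j (hKM hjK)) hxj
      (mul_mem (mem_sup_left hf) (mem_sup_right hyM))

theorem IsIndepOver.insert {G ι : Type*} [Group G] {F : Subgroup G} {H : ι → Subgroup G}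
    {J : Set ι} {i : ι} [(H i).Normal] (h : IsIndepOver F H J)
    (hi : Disjoint (F ⊔ ⨆ j ∈ J, H j) (H i)) : IsIndepOver F H (insert i J) := by
  refine ⟨?_, fun j hj => ?_⟩
  · rw [iSup_insert, sup_comm]
    exact disjoint_sup_right_of_disjoint_sup_left h.1 hi
  by_cases hji : j = i
  · subst hji
    refine hi.symm.mono_right (sup_le_sup_left (iSup₂_le fun k hk => iSup_le fun hkj => ?_) F)
    exact le_biSup H (hk.resolve_left hkj)
  · have hjJ : j ∈ J := hj.resolve_left hji
    refine (disjoint_sup_right_of_disjoint_sup_left (h.2 j hjJ) (hi.mono_left ?_)).mono_right ?_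
    · refine sup_le (le_sup_of_le_right (le_biSup H hjJ)) (sup_le_sup_left ?_ F)
      exact iSup₂_mono fun k _ => iSup_le fun _ => le_rfl
    · rw [iSup_insert]
      refine sup_le (le_sup_of_le_left le_sup_left) (sup_le ?_ ?_)
      · exact iSup_le fun _ => le_sup_right
      · exact le_sup_of_le_left le_sup_right

end Subgroup

open Subgroup in
theorem stmt_0 {G : Type*} [Group G] {ι : Type*} (F : Subgroup G) (hF : F.Normal)
    (H : ι → Subgroup G) (hHnorm : ∀ i, (H i).Normal) (hHsimple : ∀ i, IsSimpleGroup (H i))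
    (hgen : F ⊔ (⨆ i, H i) = ⊤) :
    ∃ J : Set ι,
      ((∀ j ∈ J, ∀ x ∈ F, ∀ y ∈ H j, Commute x y) ∧
        (∀ j ∈ J, ∀ j' ∈ J, j ≠ j' → ∀ x ∈ H j, ∀ y ∈ H j', Commute x y)) ∧
      (F ⊓ (⨆ j ∈ J, H j) = ⊥ ∧
        (∀ j ∈ J, H j ⊓ (F ⊔ ⨆ j' ∈ J, ⨆ (_ : j' ≠ j), H j') = ⊥)) ∧
      F ⊔ (⨆ j ∈ J, H j) = ⊤ := by
  obtain ⟨J, -, hJ⟩ := zorn_subset_nonempty {J | IsIndepOver F H J}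
    (fun c hcS hc hne => ⟨⋃₀ c, IsIndepOver.sUnion hc hne hcS,
      fun _ hs => Set.subset_sUnion_of_mem hs⟩) ∅ (by simp [IsIndepOver])
  have hind : IsIndepOver F H J := hJ.prop
  refine ⟨J, ⟨fun j hj x hx y hy => ?_, fun j hj j' hj' hne x hx y hy => ?_⟩,
    ⟨hind.1.eq_bot, fun j hj => (hind.2 j hj).eq_bot⟩, ?_⟩
  · exact commute_of_normal_of_disjoint F (H j) hF (hHnorm j)
      (hind.1.mono_right (le_biSup H hj)) x y hx hy
  · refine commute_of_normal_of_disjoint (H j) (H j') (hHnorm j) (hHnorm j')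
      ((hind.2 j hj).mono_right (le_sup_of_le_right ?_)) x y hx hy
    exact le_iSup₂_of_le j' hj' (le_iSup_of_le hne.symm le_rfl)
  · refine top_le_iff.1 (hgen ▸ sup_le le_sup_left (iSup_le fun i => ?_))
    rcases disjoint_or_le_of_isSimpleGroup (F ⊔ ⨆ j ∈ J, H j) (H i) with hdisj | hle
    · have hiJ : i ∈ J := hJ.mem_of_prop_insert (hind.insert hdisj)
      exact le_sup_of_le_right (le_biSup H hiJ)
    · exact hle
end

section
/- Every normal subgroup of a semisimple group is semisimple: if G is a group with Soc(G) = ⊤ and N is a normal subgroup of G, then the group N satisfies Soc(N) = ⊤. -/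
/-- The socle of a group: the subgroup generated by the union of all
subgroups that are normal and simple as groups. -/
def Socle (G : Type*) [Group G] : Subgroup G :=
  sSup {N : Subgroup G | N.Normal ∧ IsSimpleGroup N}

/-- A homomorphic image of a semisimple group is semisimple. -/
theorem socle_eq_top_of_surjective {G H : Type*} [Group G] [Group H] (f : G →* H)
    (hf : Function.Surjective f) (hG : Socle G = ⊤) : Socle H = ⊤ := by
  have hle : Socle G ≤ (Socle H).comap f := by
    refine sSup_le ?_
    rintro S ⟨hS, hsimple⟩
    rw [← Subgroup.map_le_iff_le_comap]
    by_cases hbot : S.map f = ⊥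
    · simp [hbot]
    · have : Nontrivial (S.map f) := (Subgroup.nontrivial_iff_ne_bot _).2 hbot
      exact le_sSup ⟨hS.map f hf, IsSimpleGroup.isSimpleGroup_of_surjective
        (f.subgroupMap S) (f.subgroupMap_surjective S)⟩
  rw [hG, ← Subgroup.map_le_iff_le_comap, Subgroup.map_top_of_surjective f hf] at hle
  exact top_le_iff.1 hle

/-- Among the normal subgroups disjoint from a given subgroup there is a maximal one. -/
theorem Subgroup.exists_maximal_normal_disjoint {G : Type*} [Group G] (N : Subgroup G) :
    ∃ K : Subgroup G, Maximal (fun K => K.Normal ∧ Disjoint K N) K := by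
  obtain ⟨K, -, hK⟩ := zorn_le_nonempty₀ {K : Subgroup G | K.Normal ∧ Disjoint K N}
    (fun c hc hchain K₀ hK₀ => by
      refine ⟨sSup c, ⟨⟨fun x hx g => ?_⟩, ?_⟩, fun _ h => le_sSup h⟩
      · rw [Subgroup.mem_sSup_of_directedOn ⟨K₀, hK₀⟩ hchain.directedOn] at hx ⊢
        obtain ⟨K, hKc, hxK⟩ := hx
        exact ⟨K, hKc, (hc hKc).1.conj_mem x hxK g⟩
      · rw [Subgroup.disjoint_def]
        intro x hx hxN
        rw [Subgroup.mem_sSup_of_directedOn ⟨K₀, hK₀⟩ hchain.directedOn] at hx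
        obtain ⟨K, hKc, hxK⟩ := hx
        exact Subgroup.disjoint_def.1 (hc hKc).2 hxK hxN)
    ⊥ ⟨inferInstance, disjoint_bot_left⟩
  exact ⟨K, hK⟩

/-- A simple subgroup is contained in a given normal subgroup or disjoint from it. -/
theorem Subgroup.Normal.le_or_disjoint_of_isSimpleGroup {G : Type*} [Group G] {S M : Subgroup G}
    (hM : M.Normal) (hS : IsSimpleGroup S) : S ≤ M ∨ Disjoint S M := by
  rcases (hM.subgroupOf S).eq_bot_or_eq_top with h | h
  · exact Or.inr (Subgroup.subgroupOf_eq_bot.1 h).symm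
  · exact Or.inl (Subgroup.subgroupOf_eq_top.1 h)

/-- Normal subgroups of semisimple groups have normal complements. -/
theorem Subgroup.Normal.exists_normal_disjoint_sup_eq_top {G : Type*} [Group G]
    (hG : Socle G = ⊤) {N : Subgroup G} (hN : N.Normal) :
    ∃ K : Subgroup G, K.Normal ∧ Disjoint K N ∧ K ⊔ N = ⊤ := by
  obtain ⟨K, hK⟩ := N.exists_maximal_normal_disjoint
  have hKn : K.Normal := hK.prop.1
  refine ⟨K, hKn, hK.prop.2, top_le_iff.1 ?_⟩
  rw [← hG]
  refine sSup_le ?_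
  rintro S ⟨hS, hsimple⟩
  rcases (Subgroup.sup_normal K N).le_or_disjoint_of_isSimpleGroup hsimple with h | h
  · exact h
  · have hdisj : Disjoint (K ⊔ S) N := by
      rw [Subgroup.disjoint_def]
      intro x hx hxN
      obtain ⟨k, hk, s, hs, rfl⟩ := Subgroup.mem_sup_of_normal_left.1 hx
      have hs' : s ∈ K ⊔ N := by
        have := mul_mem (inv_mem ((le_sup_left : K ≤ K ⊔ N) hk))
          ((le_sup_right : N ≤ K ⊔ N) hxN)
        rwa [inv_mul_cancel_left] at this
      obtain rfl := Subgroup.disjoint_def.1 h hs hs'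
      rw [mul_one] at hxN ⊢
      exact Subgroup.disjoint_def.1 hK.prop.2 hk hxN
    exact (le_sup_right.trans (hK.le_of_ge ⟨Subgroup.sup_normal K S, hdisj⟩ le_sup_left)).trans
      le_sup_left

theorem stmt_1 {G : Type*} [Group G] (hG : Socle G = ⊤)
    (N : Subgroup G) (hN : N.Normal) : Socle N = ⊤ := by
  obtain ⟨K, hK, hdisj, hsup⟩ := hN.exists_normal_disjoint_sup_eq_top hG
  let f : N →* G ⧸ K := (QuotientGroup.mk' K).comp N.subtype
  have hf : Function.Bijective f := by
    constructor
    · rw [injective_iff_map_eq_one]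
      intro n hn
      exact Subtype.ext (Subgroup.disjoint_def.1 hdisj ((QuotientGroup.eq_one_iff _).1 hn) n.2)
    · intro q
      obtain ⟨g, rfl⟩ := QuotientGroup.mk'_surjective K q
      obtain ⟨k, hk, n, hn, rfl⟩ := Subgroup.mem_sup_of_normal_left.1
        (hsup.symm ▸ Subgroup.mem_top g : g ∈ K ⊔ N)
      refine ⟨⟨n, hn⟩, ?_⟩
      have hk1 : QuotientGroup.mk' K k = 1 := (QuotientGroup.eq_one_iff k).2 hk
      simp only [map_mul, hk1, one_mul]
      rfl
  let e : N ≃* G ⧸ K := MulEquiv.ofBijective f hf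
  exact socle_eq_top_of_surjective (e.symm.toMonoidHom.comp (QuotientGroup.mk' K))
    (e.symm.surjective.comp (QuotientGroup.mk'_surjective K)) hG
end

section
/- Every quotient of a semisimple group is semisimple: if G is a group with Soc(G) = ⊤ and N is a normal subgroup of G, then the quotient group G/N satisfies Soc(G/N) = ⊤. -/
/-- A surjective homomorphism maps the socle into the socle, since the image of a simple normal
subgroup is trivial or a simple normal subgroup. -/
theorem map_socle_le_of_surjective {G H : Type*} [Group G] [Group H] (f : G →* H)
    (hf : Function.Surjective f) : (Socle G).map f ≤ Socle H := by
  rw [Subgroup.map_le_iff_le_comap]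
  refine sSup_le fun S ⟨hS, hsimple⟩ => ?_
  rw [← Subgroup.map_le_iff_le_comap]
  rcases eq_or_ne (S.map f) ⊥ with hbot | hbot
  · exact hbot ▸ bot_le
  · have : Nontrivial (S.map f) := (Subgroup.nontrivial_iff_ne_bot _).2 hbot
    exact le_sSup ⟨hS.map f hf, IsSimpleGroup.isSimpleGroup_of_surjective (f.subgroupMap S)
      (f.subgroupMap_surjective S)⟩

theorem stmt_2 {G : Type*} [Group G] (hG : Socle G = ⊤)
    (N : Subgroup G) (hN : N.Normal) : Socle (G ⧸ N) = ⊤ := by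
  have hf := QuotientGroup.mk'_surjective N
  have h := map_socle_le_of_surjective (QuotientGroup.mk' N) hf
  rwa [hG, Subgroup.map_top_of_surjective _ hf, top_le_iff] at h
end

section
/- Let G be a group and (S i)_{i ∈ ι} a family of simple groups such that S i and S j are not isomorphic as groups whenever i ≠ j. Then the family of isotypical components (G_{S i})_{i ∈ ι} satisfies: (CC) for all distinct i, j ∈ ι, every element of G_{S i} commutes with every element of G_{S j}; and (MI) for each i ∈ ι, G_{S i} ⊓ (⨆_{j ≠ i} G_{S j}) = ⊥. -/
/-- The isotypical `S`-component of a group `G`: the subgroup generated by the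
union of all subgroups of `G` that are normal in `G`, simple as groups, and
isomorphic to `S`. -/
def IsoComponent (G : Type*) [Group G] (S : Type*) [Group S] : Subgroup G :=
  sSup {N : Subgroup G | N.Normal ∧ IsSimpleGroup N ∧ Nonempty (N ≃* S)}

namespace Subgroup

variable {G : Type*} [Group G]

theorem eq_of_le_of_normal_of_isSimpleGroup {A N : Subgroup G} (hA : A.Normal)
    (hN : IsSimpleGroup N) (hAN : A ≤ N) (hA0 : A ≠ ⊥) : A = N := by
  rcases (hA.subgroupOf N).eq_bot_or_eq_top with h | h
  · exact absurd ((subgroupOf_eq_bot.mp h).eq_bot_of_le hAN) hA0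
  · exact le_antisymm hAN (subgroupOf_eq_top.mp h)

theorem nonempty_mulEquiv_map_of_disjoint_ker {H : Type*} [Group H] (f : G →* H)
    {A : Subgroup G} (hA : A ⊓ f.ker = ⊥) : Nonempty (A ≃* A.map f) := by
  have hinj : Function.Injective (f.domRestrict A) := by
    rw [injective_iff_map_eq_one]
    intro a ha
    have : (a : G) ∈ A ⊓ f.ker := ⟨a.2, ha⟩
    rw [hA, mem_bot] at this
    exact Subtype.ext this
  exact ⟨(MonoidHom.ofInjective hinj).trans
    (MulEquiv.subgroupCongr (MonoidHom.domRestrict_range A f))⟩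

/-- A normal subgroup which avoids `M` and lies in `N ⊔ M` is isomorphic to the simple group `N`. -/
theorem nonempty_mulEquiv_of_le_sup {A N M : Subgroup G} (hA : A.Normal) (hM : M.Normal)
    (hN : IsSimpleGroup N) (hle : A ≤ N ⊔ M) (hA0 : A ≠ ⊥) (hAM : A ⊓ M = ⊥)
    (hNM : N ⊓ M = ⊥) : Nonempty (A ≃* N) := by
  obtain ⟨eA⟩ := nonempty_mulEquiv_map_of_disjoint_ker (QuotientGroup.mk' M) (A := A)
    (by rwa [QuotientGroup.ker_mk'])
  obtain ⟨eN⟩ := nonempty_mulEquiv_map_of_disjoint_ker (QuotientGroup.mk' M) (A := N)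
    (by rwa [QuotientGroup.ker_mk'])
  have hne : A.map (QuotientGroup.mk' M) ≠ ⊥ := by
    rw [Ne, map_eq_bot_iff, QuotientGroup.ker_mk']
    intro h
    exact hA0 (by rwa [inf_eq_left.mpr h] at hAM)
  have hmap : A.map (QuotientGroup.mk' M) ≤ N.map (QuotientGroup.mk' M) := by
    rw [map_le_map_iff, QuotientGroup.ker_mk']
    exact hle
  have heq := eq_of_le_of_normal_of_isSimpleGroup
    (hA.map _ (QuotientGroup.mk'_surjective M)) eN.symm.isSimpleGroup hmap hne
  exact ⟨eA.trans ((MulEquiv.subgroupCongr heq).trans eN.symm)⟩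

theorem exists_normal_le_mulEquiv_of_le_sSup_finite {F : Set (Subgroup G)} (hF : F.Finite)
    (hX : ∀ N ∈ F, N.Normal ∧ IsSimpleGroup N) :
    (sSup F).Normal ∧ ∀ A : Subgroup G, A.Normal → A ≠ ⊥ → A ≤ sSup F →
      ∃ B ≤ A, B.Normal ∧ ∃ N ∈ F, Nonempty (B ≃* N) := by
  induction F, hF using Set.Finite.induction_on with
  | empty =>
    rw [sSup_empty]
    exact ⟨inferInstance, fun A _ h0 hle => absurd (le_bot_iff.mp hle) h0⟩
  | @insert N F _ _ ih =>
    obtain ⟨hM, ih⟩ := ih fun K hK => hX K (Set.mem_insert_of_mem _ hK)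
    obtain ⟨hN, hNs⟩ := hX N (Set.mem_insert _ _)
    rw [sSup_insert]
    refine ⟨inferInstance, fun A hA hA0 hle => ?_⟩
    by_cases hAM : A ⊓ sSup F = ⊥
    · by_cases hNM : N ⊓ sSup F = ⊥
      · exact ⟨A, le_rfl, hA, N, Set.mem_insert _ _,
          nonempty_mulEquiv_of_le_sup hA hM hNs hle hA0 hAM hNM⟩
      · have h := eq_of_le_of_normal_of_isSimpleGroup inferInstance hNs inf_le_left hNM
        rw [sup_eq_right.mpr (inf_eq_left.mp h)] at hle
        exact absurd (by rwa [inf_eq_left.mpr hle] at hAM) hA0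
    · obtain ⟨B, hBA, hB, K, hK, e⟩ := ih (A ⊓ sSup F) inferInstance hAM inf_le_right
      exact ⟨B, hBA.trans inf_le_left, hB, K, Set.mem_insert_of_mem _ hK, e⟩

theorem exists_finite_subset_mem_sSup {X : Set (Subgroup G)} {z : G} (hz : z ∈ sSup X) :
    ∃ F ⊆ X, F.Finite ∧ z ∈ sSup F := by
  rw [sSup_eq_iSup'] at hz
  induction hz using iSup_induction' with
  | hp N x hx =>
    exact ⟨{N.1}, by simp, Set.finite_singleton _, by simpa using hx⟩
  | h1 => exact ⟨∅, Set.empty_subset _, Set.finite_empty, one_mem _⟩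
  | hmul x y _ _ hx hy =>
    obtain ⟨F, hF, hFf, hxF⟩ := hx
    obtain ⟨E, hE, hEf, hyE⟩ := hy
    have hFE : sSup F ≤ sSup (F ∪ E) := sSup_le_sSup Set.subset_union_left
    have hEF : sSup E ≤ sSup (F ∪ E) := sSup_le_sSup Set.subset_union_right
    exact ⟨F ∪ E, Set.union_subset hF hE, hFf.union hEf, mul_mem (hFE hxF) (hEF hyE)⟩

/-- A nontrivial normal subgroup lying in a join of simple normal subgroups contains a normal
subgroup isomorphic to one of them. -/
theorem exists_normal_le_mulEquiv_of_le_sSup {X : Set (Subgroup G)}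
    (hX : ∀ N ∈ X, N.Normal ∧ IsSimpleGroup N) {A : Subgroup G} (hA : A.Normal) (hA0 : A ≠ ⊥)
    (hle : A ≤ sSup X) : ∃ B ≤ A, B.Normal ∧ ∃ N ∈ X, Nonempty (B ≃* N) := by
  obtain ⟨⟨z, hzA⟩, hz⟩ := A.ne_bot_iff_exists_ne_one.mp hA0
  obtain ⟨F, hFX, hF, hzF⟩ := exists_finite_subset_mem_sSup (hle hzA)
  obtain ⟨hFn, h⟩ := exists_normal_le_mulEquiv_of_le_sSup_finite hF fun N hN => hX N (hFX hN)
  obtain ⟨B, hBA, hB, N, hN, e⟩ := h (A ⊓ sSup F) inferInstance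
    (fun h0 => hz (Subtype.ext ((mem_bot).mp (h0 ▸ mem_inf.mpr ⟨hzA, hzF⟩)))) inf_le_right
  exact ⟨B, hBA.trans inf_le_left, hB, N, hFX hN, e⟩

end Subgroup

theorem IsoComponent.normal (G : Type*) [Group G] (S : Type*) [Group S] :
    (IsoComponent G S).Normal :=
  Subgroup.sSup_normal _ fun _ hN => hN.1

theorem iSup_isoComponent_eq_sSup (G : Type*) [Group G] {ι : Type*} (S : ι → Type*)
    [∀ i, Group (S i)] (p : ι → Prop) :
    ⨆ j, ⨆ (_ : p j), IsoComponent G (S j) = sSup {N : Subgroup G |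
      N.Normal ∧ IsSimpleGroup N ∧ ∃ j, p j ∧ Nonempty (N ≃* S j)} := by
  apply le_antisymm
  · exact iSup₂_le fun j hj => sSup_le_sSup fun N hN => ⟨hN.1, hN.2.1, j, hj, hN.2.2⟩
  · refine sSup_le ?_
    rintro N ⟨hN, hNs, j, hj, e⟩
    exact le_iSup₂_of_le j hj (le_sSup ⟨hN, hNs, e⟩)

theorem stmt_7 {G : Type*} [Group G] {ι : Type*} (S : ι → Type*)
    [∀ i, Group (S i)] (hSsimple : ∀ i, IsSimpleGroup (S i))
    (hSiso : ∀ i j, i ≠ j → IsEmpty (S i ≃* S j)) :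
    (∀ i j, i ≠ j → ∀ x ∈ IsoComponent G (S i), ∀ y ∈ IsoComponent G (S j), Commute x y) ∧
      (∀ i, IsoComponent G (S i) ⊓ (⨆ j, ⨆ (_ : j ≠ i), IsoComponent G (S j)) = ⊥) := by
  have hMI : ∀ i, IsoComponent G (S i) ⊓
      (⨆ j, ⨆ (_ : j ≠ i), IsoComponent G (S j)) = ⊥ := by
    intro i
    by_contra hne
    have (j : ι) := IsoComponent.normal G (S j)
    obtain ⟨B, hBle, hB, N, ⟨-, hN, ⟨eN⟩⟩, ⟨eB⟩⟩ :=
      Subgroup.exists_normal_le_mulEquiv_of_le_sSup (fun N hN => ⟨hN.1, hN.2.1⟩)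
        inferInstance hne inf_le_left
    have hBs : IsSimpleGroup B := eB.isSimpleGroup
    have hB0 : B ≠ ⊥ := (Subgroup.nontrivial_iff_ne_bot B).mp inferInstance
    obtain ⟨C, hCB, hC, N', ⟨-, hN', j, hj, ⟨eN'⟩⟩, ⟨eC⟩⟩ :=
      Subgroup.exists_normal_le_mulEquiv_of_le_sSup (fun N hN => ⟨hN.1, hN.2.1⟩)
        hB hB0 ((hBle.trans inf_le_right).trans (iSup_isoComponent_eq_sSup G S (· ≠ i)).le)
    have hC0 : C ≠ ⊥ := (Subgroup.nontrivial_iff_ne_bot C).mp eC.toEquiv.nontrivial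
    obtain rfl := Subgroup.eq_of_le_of_normal_of_isSimpleGroup hC hBs hCB hC0
    exact (hSiso j i hj).false (eN'.symm.trans (eC.symm.trans (eB.trans eN)))
  refine ⟨fun i j hij x hx y hy => ?_, hMI⟩
  refine Subgroup.commute_of_normal_of_disjoint _ _ (IsoComponent.normal G (S i))
    (IsoComponent.normal G (S j)) ?_ x y hx hy
  exact (disjoint_iff.mpr (hMI i)).mono_right
    (le_iSup₂_of_le (f := fun j (_ : j ≠ i) => IsoComponent G (S j)) j hij.symm le_rfl)
end

section
/- Let G be a group and (S i)_{i ∈ ι} a family of simple groups such that S i and S j are not isomorphic as groups whenever i ≠ j, and such that every subgroup of G that is normal in G and simple as a group is isomorphic to S i for some i ∈ ι. Then the family of isotypical components (G_{S i})_{i ∈ ι} satisfies: for all distinct i, j, every element of G_{S i} commutes with every element of G_{S j}; for each i, G_{S i} ⊓ (⨆_{j ≠ i} G_{S j}) = ⊥; and ⨆ i, G_{S i} = Soc(G). (The socle decomposes as the internal restricted direct sum of the isotypical components.) -/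
section Commuting

variable {G : Type*} [Group G]

theorem commute_of_mem_sSup_left {F : Set (Subgroup G)} {x y : G}
    (h : ∀ N ∈ F, ∀ n ∈ N, Commute n y) (hx : x ∈ sSup F) : Commute x y := by
  have hle : sSup F ≤ Subgroup.centralizer {y} :=
    sSup_le fun N hN n hn => Subgroup.mem_centralizer_singleton_iff.2 (h N hN n hn)
  exact Subgroup.mem_centralizer_singleton_iff.1 (hle hx)

theorem commute_of_mem_sSup {F F' : Set (Subgroup G)}
    (h : ∀ N ∈ F, ∀ M ∈ F', ∀ x ∈ N, ∀ y ∈ M, Commute x y) {x y : G}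
    (hx : x ∈ sSup F) (hy : y ∈ sSup F') : Commute x y :=
  commute_of_mem_sSup_left (fun N hN n hn => (commute_of_mem_sSup_left
    (fun M hM m hm => (h N hN M hM n hn m hm).symm) hy).symm) hx

/-- Distinct normal simple subgroups commute elementwise. -/
theorem commute_of_normal_simple_ne {N M : Subgroup G} (hN : N.Normal) (hM : M.Normal)
    (hNs : IsSimpleGroup N) (hMs : IsSimpleGroup M) (hne : N ≠ M) :
    ∀ x ∈ N, ∀ y ∈ M, Commute x y := by
  have hdisj : Disjoint N M := by
    rcases (inferInstance : (M.subgroupOf N).Normal).eq_bot_or_eq_top with h | h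
    · exact (Subgroup.subgroupOf_eq_bot.1 h).symm
    · have hNM : N ≤ M := Subgroup.subgroupOf_eq_top.1 h
      rcases (inferInstance : (N.subgroupOf M).Normal).eq_bot_or_eq_top with h' | h'
      · exact Subgroup.subgroupOf_eq_bot.1 h'
      · exact absurd (le_antisymm hNM (Subgroup.subgroupOf_eq_top.1 h')) hne
  exact fun x hx y hy => Subgroup.commute_of_normal_of_disjoint N M hN hM hdisj x y hx hy

theorem exists_finset_mem_sSup {F : Set (Subgroup G)} {x : G} (hx : x ∈ sSup F) :
    ∃ t : Finset (Subgroup G), (t : Set (Subgroup G)) ⊆ F ∧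
      x ∈ sSup (t : Set (Subgroup G)) := by
  classical
  rw [sSup_eq_iSup'] at hx
  induction hx using Subgroup.iSup_induction' with
  | hp N x hx =>
    exact ⟨{N.1}, by simp, by simpa using hx⟩
  | h1 => exact ⟨∅, by simp, one_mem _⟩
  | hmul x y _ _ hx hy =>
    obtain ⟨t, ht, hxt⟩ := hx
    obtain ⟨u, hu, hyu⟩ := hy
    refine ⟨t ∪ u, by simp [ht, hu], mul_mem ?_ ?_⟩
    · exact (sSup_le_sSup (by simp) : sSup (t : Set (Subgroup G)) ≤ _) hxt
    · exact (sSup_le_sSup (by simp) : sSup (u : Set (Subgroup G)) ≤ _) hyu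

/-- A central element of a join of pairwise commuting simple subgroups lies in the join of the
abelian ones. -/
theorem mem_sSup_commutative_of_central {F : Set (Subgroup G)}
    (hs : ∀ N ∈ F, IsSimpleGroup N)
    (hc : ∀ N ∈ F, ∀ M ∈ F, N ≠ M → ∀ x ∈ N, ∀ y ∈ M, Commute x y) {z : G}
    (hz : z ∈ sSup F) (hzc : ∀ N ∈ F, ∀ n ∈ N, Commute z n) :
    z ∈ sSup {N ∈ F | ∀ x ∈ N, ∀ y ∈ N, Commute x y} := by
  classical
  obtain ⟨t, ht, hzt⟩ := exists_finset_mem_sSup hz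
  replace hzc : ∀ N ∈ t, ∀ n ∈ N, Commute z n := fun N hN => hzc N (ht hN)
  clear hz
  induction t using Finset.induction_on generalizing z with
  | empty =>
    have : z = 1 := by simpa using hzt
    exact this ▸ one_mem _
  | insert N t hNt ih =>
    have hNF : N ∈ F := ht (by simp)
    have htF : (t : Set (Subgroup G)) ⊆ F := fun M hM => ht (by simp_all)
    have hNc : ∀ n ∈ N, ∀ M ∈ t, ∀ m ∈ M, Commute n m := fun n hn M hM =>
      hc N hNF M (htF hM) (fun h => hNt (h ▸ hM)) n hn
    have hcomm : ∀ n ∈ N, ∀ c ∈ sSup (t : Set (Subgroup G)), Commute n c :=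
      fun n hn c hcm => (commute_of_mem_sSup_left
        (fun M hM m hm => (hNc n hn M hM m hm).symm) hcm).symm
    have hnorm : N ≤ Subgroup.normalizer (sSup (t : Set (Subgroup G)) : Subgroup G) :=
      le_trans (fun n hn => Subgroup.mem_centralizer_iff.2 fun c hcm => (hcomm n hn c hcm).symm)
        (Subgroup.centralizer_le_normalizer _)
    rw [Finset.coe_insert, sSup_insert, ← SetLike.mem_coe,
      Subgroup.coe_mul_of_left_le_normalizer_right _ _ hnorm] at hzt
    obtain ⟨n, hn, c, hct, rfl⟩ := hzt
    have hn : n ∈ N := hn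
    have hct : c ∈ sSup (t : Set (Subgroup G)) := hct
    have hnN : ∀ m ∈ N, Commute n m := fun m hm => by
      have := (hzc N (by simp) m hm).mul_left (hcomm m hm c hct).symm.inv_left
      rwa [mul_inv_cancel_right] at this
    refine mul_mem ?_ (ih htF hct fun M hM m hm => ?_)
    · have := hs N hNF
      rcases (inferInstance : (Subgroup.center N).Normal).eq_bot_or_eq_top with h | h
      · have hmem : (⟨n, hn⟩ : N) ∈ Subgroup.center N :=
          Subgroup.mem_center_iff.2 fun m => Subtype.ext (hnN m m.2).symm.eq
        rw [h, Subgroup.mem_bot] at hmem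
        have : n = 1 := congrArg Subtype.val hmem
        exact this ▸ one_mem _
      · have hNc : ∀ x ∈ N, ∀ y ∈ N, Commute x y := fun x hx y hy => by
          have hy' : (⟨y, hy⟩ : N) ∈ Subgroup.center N := h ▸ Subgroup.mem_top _
          exact congrArg Subtype.val (Subgroup.mem_center_iff.1 hy' ⟨x, hx⟩)
        have hle : N ≤ sSup {N ∈ F | ∀ x ∈ N, ∀ y ∈ N, Commute x y} := le_sSup ⟨hNF, hNc⟩
        exact hle hn
    · have := (hNc n hn M hM m hm).inv_left.mul_left (hzc M (by simp [hM]) m hm)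
      rwa [inv_mul_cancel_left] at this

theorem exists_pow_eq_one_of_mem_sSup {F : Set (Subgroup G)} (P : Submonoid ℕ)
    (hc : ∀ N ∈ F, ∀ M ∈ F, ∀ x ∈ N, ∀ y ∈ M, Commute x y)
    (hP : ∀ N ∈ F, ∀ x ∈ N, ∃ n ∈ P, x ^ n = 1) {x : G} (hx : x ∈ sSup F) :
    ∃ n ∈ P, x ^ n = 1 := by
  have key : x ∈ sSup F ∧ ∃ n ∈ P, x ^ n = 1 := by
    have hx' := hx
    rw [sSup_eq_iSup'] at hx'
    induction hx' using Subgroup.iSup_induction' with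
    | hp N x h => exact ⟨hx, hP N.1 N.2 x h⟩
    | h1 => exact ⟨hx, 1, P.one_mem, one_pow _⟩
    | hmul x y hx1 hy1 ihx ihy =>
      rw [← sSup_eq_iSup'] at hx1 hy1
      obtain ⟨-, n, hn, hxn⟩ := ihx hx1
      obtain ⟨-, m, hm, hym⟩ := ihy hy1
      refine ⟨hx, n * m, P.mul_mem hn hm, ?_⟩
      rw [(commute_of_mem_sSup hc hx1 hy1).mul_pow, pow_mul, hxn, mul_comm n m, pow_mul, hym,
        one_pow, one_pow, one_mul]
  exact key.2

theorem prime_card_of_simple_of_commute {N : Subgroup G} (hs : IsSimpleGroup N)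
    (hc : ∀ x ∈ N, ∀ y ∈ N, Commute x y) : (Nat.card N).Prime := by
  let _ : CommGroup N :=
    { (inferInstance : Group N) with
      mul_comm := fun x y => Subtype.ext (hc x x.2 y y.2).eq }
  exact IsSimpleGroup.prime_card

theorem pow_card_eq_one_of_mem {N : Subgroup G} {x : G} (hx : x ∈ N) : x ^ Nat.card N = 1 :=
  congrArg Subtype.val (pow_card_eq_one' (x := (⟨x, hx⟩ : N)))

theorem commute_of_ne_imp_commute {N M : Subgroup G}
    (hne : N ≠ M → ∀ x ∈ N, ∀ y ∈ M, Commute x y) (hN : ∀ x ∈ N, ∀ y ∈ N, Commute x y) :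
    ∀ x ∈ N, ∀ y ∈ M, Commute x y := by
  by_cases h : N = M
  · subst h; exact hN
  · exact hne h

/-- Joins of two families of normal simple subgroups with no isomorphic members in common intersect
trivially. -/
theorem sSup_inf_sSup_eq_bot_of_not_iso {F F' : Set (Subgroup G)}
    (hF : ∀ N ∈ F, N.Normal ∧ IsSimpleGroup N) (hF' : ∀ N ∈ F', N.Normal ∧ IsSimpleGroup N)
    (hiso : ∀ N ∈ F, ∀ M ∈ F, Nonempty (N ≃* M))
    (hniso : ∀ N ∈ F, ∀ M ∈ F', IsEmpty (N ≃* M)) :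
    sSup F ⊓ sSup F' = ⊥ := by
  rw [eq_bot_iff]
  rintro z ⟨hz, hz'⟩
  have hcomm : ∀ N ∈ F, ∀ M ∈ F', ∀ x ∈ N, ∀ y ∈ M, Commute x y := fun N hN M hM =>
    commute_of_normal_simple_ne (hF N hN).1 (hF' M hM).1 (hF N hN).2 (hF' M hM).2
      fun h => (hniso N hN M hM).false (h ▸ MulEquiv.refl N)
  have hself : ∀ {E : Set (Subgroup G)}, (∀ N ∈ E, N.Normal ∧ IsSimpleGroup N) →
      ∀ N ∈ E, ∀ M ∈ E, N ≠ M → ∀ x ∈ N, ∀ y ∈ M, Commute x y := fun hE N hN M hM =>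
    commute_of_normal_simple_ne (hE N hN).1 (hE M hM).1 (hE N hN).2 (hE M hM).2
  have hab := mem_sSup_commutative_of_central (fun N hN => (hF N hN).2) (hself hF) hz
    fun N hN n hn => (commute_of_mem_sSup_left
      (fun M hM m hm => (hcomm N hN M hM n hn m hm).symm) hz')
  have hab' := mem_sSup_commutative_of_central (fun N hN => (hF' N hN).2) (hself hF') hz'
    fun M hM m hm => commute_of_mem_sSup_left (fun N hN n hn => hcomm N hN M hM n hn m hm) hz
  rcases Set.eq_empty_or_nonempty {N ∈ F | ∀ x ∈ N, ∀ y ∈ N, Commute x y} with he | ⟨N, hN, hNc⟩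
  · rwa [he, sSup_empty] at hab
  have hp := prime_card_of_simple_of_commute (hF N hN).2 hNc
  obtain ⟨n, hn, hzn⟩ := exists_pow_eq_one_of_mem_sSup (Submonoid.powers (Nat.card N))
    (fun M hM K hK => commute_of_ne_imp_commute (hself hF M hM.1 K hK.1) hM.2)
    (fun M hM x hx => ⟨Nat.card N, Submonoid.mem_powers _, by
      obtain ⟨e⟩ := hiso N hN M hM.1
      rw [Nat.card_congr e.toEquiv]
      exact pow_card_eq_one_of_mem hx⟩) hab
  let P : Submonoid ℕ :=
    { carrier := {m | (Nat.card N).Coprime m}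
      one_mem' := Nat.coprime_one_right _
      mul_mem' := fun ha hb => Nat.Coprime.mul_right ha hb }
  obtain ⟨m, hm, hzm⟩ := exists_pow_eq_one_of_mem_sSup P
    (fun M hM K hK => commute_of_ne_imp_commute (hself hF' M hM.1 K hK.1) hM.2)
    (fun M hM x hx => ⟨Nat.card M, by
      have hq := prime_card_of_simple_of_commute (hF' M hM.1).2 hM.2
      refine (Nat.coprime_primes hp hq).2 fun h => ?_
      have := Fact.mk hp
      exact (hniso N hN M hM.1).false (mulEquivOfPrimeCardEq rfl h.symm),
      pow_card_eq_one_of_mem hx⟩) hab'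
  obtain ⟨k, rfl⟩ := hn
  have hcop : Nat.Coprime (Nat.card N ^ k) m := Nat.Coprime.pow_left k hm
  have := pow_gcd_eq_one.2 ⟨hzn, hzm⟩
  rwa [hcop.gcd_eq_one, pow_one] at this

end Commuting

theorem stmt_8 {G : Type*} [Group G] {ι : Type*} (S : ι → Type*)
    [∀ i, Group (S i)] (hSsimple : ∀ i, IsSimpleGroup (S i))
    (hSiso : ∀ i j, i ≠ j → IsEmpty (S i ≃* S j))
    (hcover : ∀ N : Subgroup G, N.Normal → IsSimpleGroup N → ∃ i, Nonempty (N ≃* S i)) :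
    (∀ i j, i ≠ j → ∀ x ∈ IsoComponent G (S i), ∀ y ∈ IsoComponent G (S j), Commute x y) ∧
      (∀ i, IsoComponent G (S i) ⊓ (⨆ j, ⨆ (_ : j ≠ i), IsoComponent G (S j)) = ⊥) ∧
      (⨆ i, IsoComponent G (S i)) = Socle G := by
  refine ⟨fun i j hij x hx y hy => commute_of_mem_sSup ?_ hx hy, fun i => ?_, ?_⟩
  · rintro N ⟨hN, hNs, ⟨e⟩⟩ M ⟨hM, hMs, ⟨f⟩⟩
    refine commute_of_normal_simple_ne hN hM hNs hMs ?_
    rintro rfl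
    exact (hSiso i j hij).false (e.symm.trans f)
  · have hle : (⨆ j, ⨆ (_ : j ≠ i), IsoComponent G (S j)) ≤
        sSup {N : Subgroup G | (N.Normal ∧ IsSimpleGroup N) ∧ ∃ j, j ≠ i ∧ Nonempty (N ≃* S j)} :=
      iSup₂_le fun j hj => sSup_le_sSup fun N hN => ⟨⟨hN.1, hN.2.1⟩, j, hj, hN.2.2⟩
    refine eq_bot_iff.2 ((inf_le_inf_left _ hle).trans (le_of_eq ?_))
    refine sSup_inf_sSup_eq_bot_of_not_iso (fun N hN => ⟨hN.1, hN.2.1⟩) (fun N hN => hN.1) ?_ ?_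
    · rintro N ⟨-, -, ⟨e⟩⟩ M ⟨-, -, ⟨f⟩⟩
      exact ⟨e.trans f.symm⟩
    · rintro N ⟨-, -, ⟨e⟩⟩ M ⟨-, j, hj, ⟨f⟩⟩
      exact ⟨fun g => (hSiso i j hj.symm).false (e.symm.trans (g.trans f))⟩
  · refine le_antisymm (iSup_le fun i => sSup_le_sSup fun N hN => ⟨hN.1, hN.2.1⟩)
      (sSup_le fun N hN => ?_)
    obtain ⟨i, hi⟩ := hcover N hN.1 hN.2
    exact le_iSup_of_le i (le_sSup ⟨hN.1, hN.2, hi⟩)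
end

section
/- Normal morphisms preserve isotypical components: let G and G' be groups, f : G →* G' a normal morphism, and S a simple group. Then f(G_S) ≤ G'_S, and moreover f(G_S) is a normal subgroup of G'. -/
/-- A homomorphism restricted to a simple subgroup is either trivial or injective, so it maps the
subgroup to the trivial subgroup or to an isomorphic copy. -/
theorem Subgroup.map_eq_bot_or_nonempty_mulEquiv_map {G G' : Type*} [Group G] [Group G']
    (f : G →* G') (N : Subgroup G) [IsSimpleGroup N] :
    N.map f = ⊥ ∨ Nonempty (N ≃* N.map f) := by
  rcases (MonoidHom.normal_ker (f.subgroupMap N)).eq_bot_or_eq_top with h | h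
  · exact .inr ⟨MulEquiv.ofBijective (f.subgroupMap N)
      ⟨(MonoidHom.ker_eq_bot_iff _).1 h, f.subgroupMap_surjective N⟩⟩
  · refine .inl ((Subgroup.map_eq_bot_iff N).2 fun x hx => ?_)
    have hker : (⟨x, hx⟩ : N) ∈ (f.subgroupMap N).ker := h ▸ Subgroup.mem_top _
    exact congrArg Subtype.val hker

theorem stmt_10 {G G' : Type*} [Group G] [Group G'] (f : G →* G')
    (hf : ∀ N : Subgroup G, N.Normal → (N.map f).Normal)
    (S : Type*) [Group S] [IsSimpleGroup S] :
    (IsoComponent G S).map f ≤ IsoComponent G' S ∧ ((IsoComponent G S).map f).Normal := by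
  refine ⟨Subgroup.map_le_iff_le_comap.2 (sSup_le ?_), hf _ (IsoComponent.normal G S)⟩
  rintro N ⟨hN, hsimple, ⟨e⟩⟩
  rw [← Subgroup.map_le_iff_le_comap]
  rcases N.map_eq_bot_or_nonempty_mulEquiv_map f with h | ⟨⟨φ⟩⟩
  · exact h.le.trans bot_le
  · exact le_sSup ⟨hf N hN, φ.symm.isSimpleGroup, ⟨φ.symm.trans e⟩⟩
end

section
/- The support of a direct sum is the union of the supports: let ι be a finite index type, (G i)_{i ∈ ι} a family of groups, P = Π i, G i, and S a simple group. Then P has a normal subgroup that is simple as a group and isomorphic to S if and only if there exists i ∈ ι such that G i has a normal subgroup that is simple as a group and isomorphic to S. -/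
theorem stmt_12 {ι : Type*} [Finite ι] (G : ι → Type*) [∀ i, Group (G i)]
    (S : Type*) [Group S] [IsSimpleGroup S] :
    (∃ N : Subgroup (∀ i, G i), N.Normal ∧ IsSimpleGroup N ∧ Nonempty (N ≃* S)) ↔
      ∃ i, ∃ N : Subgroup (G i), N.Normal ∧ IsSimpleGroup N ∧ Nonempty (N ≃* S) := by
  classical
  constructor
  · rintro ⟨N, hN, hs, ⟨e⟩⟩
    obtain ⟨n, hn⟩ := exists_ne (1 : N)
    obtain ⟨i, hi⟩ : ∃ i, n.1 i ≠ 1 := by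
      by_contra! h
      exact hn (Subtype.ext (funext h))
    let f : N →* G i := (Pi.evalMonoidHom G i).comp N.subtype
    have hf : Function.Injective f := by
      rw [← MonoidHom.ker_eq_bot_iff]
      refine (MonoidHom.normal_ker f).eq_bot_or_eq_top.resolve_right fun h => hi ?_
      have : n ∈ f.ker := h ▸ Subgroup.mem_top n
      exact this
    have hrange : f.range = N.map (Pi.evalMonoidHom G i) := by
      rw [MonoidHom.range_comp, Subgroup.range_subtype]
    let e' := (MonoidHom.ofInjective hf).symm
    exact ⟨i, f.range, hrange ▸ hN.map _ (Function.surjective_eval i),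
      e'.isSimpleGroup, ⟨e'.trans e⟩⟩
  · rintro ⟨i, N, hN, hs, ⟨e⟩⟩
    let e' := (N.equivMapOfInjective (MonoidHom.mulSingle G i) (Pi.mulSingle_injective i)).symm
    refine ⟨N.map (MonoidHom.mulSingle G i), ⟨?_⟩, e'.isSimpleGroup, ⟨e'.trans e⟩⟩
    rintro _ ⟨n, hn, rfl⟩ g
    refine ⟨g i * n * (g i)⁻¹, hN.conj_mem n hn (g i), funext fun j => ?_⟩
    obtain rfl | hj := eq_or_ne j i <;> simp [*]
end

section
/- Let G be a group and (H i)_{i ∈ ι} a family of subgroups of G such that: for all distinct i, j, every element of H i commutes with every element of H j; for each i, H i ⊓ (⨆_{j ≠ i} H j) = ⊥; and ⨆ i, H i = ⊤. For each i let Σ i denote the image in G of Soc(H i) (the pushforward of the socle of the group H i along the inclusion H i ↪ G). Then Σ i ≤ Soc(G) for every i, the family (Σ i) satisfies the same commutation and independence conditions, and ⨆ i, Σ i = Soc(G). (The socle of an internal restricted direct sum is the internal restricted direct sum of the socles.) -/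
/-- A central element with `x ^ p = 1` for a prime `p` lies in the socle. -/
theorem mem_socle_of_mem_center {G : Type*} [Group G] {p : ℕ} (hp : p.Prime) {x : G}
    (hx : x ∈ Subgroup.center G) (hxp : x ^ p = 1) : x ∈ Socle G := by
  by_cases h1 : x = 1
  · exact h1 ▸ one_mem _
  have : Fact p.Prime := ⟨hp⟩
  have hcard : Nat.card (Subgroup.zpowers x) = p := by
    rw [Nat.card_zpowers, orderOf_eq_prime hxp h1]
  have hnormal : (Subgroup.zpowers x).Normal :=
    ⟨fun n hn g => by
      rwa [Subgroup.mem_center_iff.1 (Subgroup.zpowers_le.2 hx hn) g, mul_inv_cancel_right]⟩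
  exact (le_sSup ⟨hnormal, isSimpleGroup_of_prime_card hcard⟩ :
    Subgroup.zpowers x ≤ Socle G) (Subgroup.mem_zpowers x)

/-- An element of the center of `G` lying in a subgroup `K`, with `x ^ p = 1` for a
prime `p`, lies in the image of the socle of `K`. -/
theorem mem_map_socle_of_mem_center {G : Type*} [Group G] {p : ℕ} (hp : p.Prime)
    {K : Subgroup G} {x : G} (hxK : x ∈ K) (hx : x ∈ Subgroup.center G) (hxp : x ^ p = 1) :
    x ∈ (Socle K).map K.subtype := by
  refine ⟨⟨x, hxK⟩, mem_socle_of_mem_center hp ?_ (Subtype.ext hxp), rfl⟩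
  exact Subgroup.mem_center_iff.2 fun g => Subtype.ext (Subgroup.mem_center_iff.1 hx g)

/-- A normal simple subgroup of `G` contained in `K` lies in the image of the socle of `K`. -/
theorem le_map_socle_of_le {G : Type*} [Group G] {K N : Subgroup G} (hNK : N ≤ K)
    (hN : N.Normal) (hsimple : IsSimpleGroup N) : N ≤ (Socle K).map K.subtype := by
  have hle : N.subgroupOf K ≤ Socle K :=
    le_sSup ⟨hN.subgroupOf K, (Subgroup.subgroupOfEquivOfLe hNK).isSimpleGroup⟩
  simpa [Subgroup.map_subgroupOf_eq_of_le hNK] using Subgroup.map_mono (f := K.subtype) hle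

/-- A simple group with commuting elements has prime exponent. -/
theorem exists_prime_pow_eq_one {N : Type*} [Group N] [IsSimpleGroup N]
    (hcomm : ∀ x y : N, x * y = y * x) : ∃ p : ℕ, p.Prime ∧ ∀ x : N, x ^ p = 1 := by
  let _ : CommGroup N := { ‹Group N› with mul_comm := hcomm }
  exact ⟨Nat.card N, IsSimpleGroup.prime_card, fun x => pow_card_eq_one'⟩

section CommutingFamily

variable {G : Type*} [Group G] {ι : Type*} {H : ι → Subgroup G}

/-- If the pairwise commuting subgroups `H i` generate `G`, then every normal subgroup of some
`H i` is normal in `G`. -/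
theorem normal_of_subgroupOf_normal
    (hCC : ∀ i j, i ≠ j → ∀ x ∈ H i, ∀ y ∈ H j, Commute x y) (hsup : (⨆ i, H i) = ⊤)
    {i : ι} {N : Subgroup G} (hNH : N ≤ H i) (hN : (N.subgroupOf (H i)).Normal) : N.Normal := by
  rw [← Subgroup.normalizer_eq_top_iff, eq_top_iff, ← hsup]
  refine iSup_le fun j => ?_
  by_cases hij : i = j
  · subst hij
    exact Subgroup.le_normalizer_of_normal_subgroupOf hNH
  · intro y hy
    refine Subgroup.centralizer_le_normalizer _ ?_
    exact Subgroup.mem_centralizer_iff.2 fun n hn => hCC i j hij n (hNH hn) y hy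

/-- An element commuting with each member of a generating family of subgroups is central. -/
theorem mem_center_of_forall_commute (hsup : (⨆ i, H i) = ⊤) {x : G}
    (hx : ∀ i, ∀ y ∈ H i, Commute x y) : x ∈ Subgroup.center G := by
  have htop : (⊤ : Subgroup G) ≤ Subgroup.centralizer {x} := by
    rw [← hsup]
    exact iSup_le fun i y hy => Subgroup.mem_centralizer_singleton_iff.2 (hx i y hy).symm
  exact Subgroup.mem_center_iff.2 fun g =>
    Subgroup.mem_centralizer_singleton_iff.1 (htop (Subgroup.mem_top g))

theorem commute_of_mem_iSup_ne
    (hCC : ∀ i j, i ≠ j → ∀ x ∈ H i, ∀ y ∈ H j, Commute x y) {i : ι} {x y : G} (hx : x ∈ H i)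
    (hy : y ∈ ⨆ j, ⨆ (_ : j ≠ i), H j) : Commute x y := by
  have hle : (⨆ j, ⨆ (_ : j ≠ i), H j) ≤ Subgroup.centralizer {x} :=
    iSup₂_le fun j hj z hz =>
      Subgroup.mem_centralizer_singleton_iff.2 (hCC j i hj z hz x hx)
  exact (Subgroup.mem_centralizer_singleton_iff.1 (hle hy)).symm

/-- Central elements with `x ^ p = 1` for a prime `p` lie in the join of the socles of the factors. -/
theorem mem_iSup_map_socle_of_mem_center
    (hCC : ∀ i j, i ≠ j → ∀ x ∈ H i, ∀ y ∈ H j, Commute x y)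
    (hMI : ∀ i, H i ⊓ (⨆ j, ⨆ (_ : j ≠ i), H j) = ⊥) (hsup : (⨆ i, H i) = ⊤)
    {p : ℕ} (hp : p.Prime) {x : G} (hx : x ∈ Subgroup.center G) (hxp : x ^ p = 1) :
    x ∈ ⨆ i, (Socle (H i)).map (H i).subtype := by
  classical
  have key : ∀ (s : Finset ι) (x : G), x ∈ Subgroup.center G → x ^ p = 1 →
      x ∈ (⨆ i ∈ s, H i) → x ∈ ⨆ i, (Socle (H i)).map (H i).subtype := by
    intro s
    induction s using Finset.induction_on with
    | empty =>
      intro x _ _ hxs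
      have hx1 : x = 1 := by simpa using hxs
      exact hx1 ▸ one_mem _
    | insert a s ha ih =>
      intro x hx hxp hxs
      have hnormal : (H a).Normal :=
        normal_of_subgroupOf_normal hCC hsup le_rfl
          (by rw [Subgroup.subgroupOf_self]; infer_instance)
      rw [Finset.iSup_insert, Subgroup.mem_sup_of_normal_left] at hxs
      obtain ⟨h, hh, k, hk, rfl⟩ := hxs
      have hka : k ∈ ⨆ j, ⨆ (_ : j ≠ a), H j :=
        (iSup₂_le fun j hj => le_iSup₂_of_le j (fun hja => ha (hja ▸ hj)) le_rfl :
          (⨆ i ∈ s, H i) ≤ ⨆ j, ⨆ (_ : j ≠ a), H j) hk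
      have hhk : Commute h k := commute_of_mem_iSup_ne hCC hh hka
      have hhc : h ∈ Subgroup.center G := by
        refine mem_center_of_forall_commute hsup fun j y hy => ?_
        by_cases hja : a = j
        · subst hja
          have hyk : Commute y k := commute_of_mem_iSup_ne hCC hy hka
          have hyhk : Commute y (h * k) := Subgroup.mem_center_iff.1 hx y
          simpa using (hyhk.mul_right hyk.inv_right).symm
        · exact hCC a j hja h hh y hy
      have hkc : k ∈ Subgroup.center G := by simpa using mul_mem (inv_mem hhc) hx
      rw [hhk.mul_pow] at hxp
      have hhp : h ^ p = 1 := by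
        rw [← Subgroup.mem_bot, ← hMI a]
        refine ⟨pow_mem hh p, ?_⟩
        rw [eq_inv_of_mul_eq_one_left hxp]
        exact Subgroup.inv_mem _ (pow_mem hka p)
      have hkp : k ^ p = 1 := by simpa [hhp] using hxp
      exact mul_mem (Subgroup.mem_iSup_of_mem a (mem_map_socle_of_mem_center hp hh hhc hhp))
        (ih k hkc hkp hk)
  have hxtop : x ∈ ⨆ i, H i := hsup ▸ Subgroup.mem_top x
  rw [iSup_eq_iSup_finset, Subgroup.mem_iSup_of_directed] at hxtop
  · obtain ⟨s, hs⟩ := hxtop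
    exact key s x hx hxp hs
  · exact Monotone.directed_le fun s t hst => biSup_mono fun i hi =>
      Finset.mem_of_subset hst hi

end CommutingFamily


theorem stmt_13 {G : Type*} [Group G] {ι : Type*} (H : ι → Subgroup G)
    (hCC : ∀ i j, i ≠ j → ∀ x ∈ H i, ∀ y ∈ H j, Commute x y)
    (hMI : ∀ i, H i ⊓ (⨆ j, ⨆ (_ : j ≠ i), H j) = ⊥)
    (hsup : (⨆ i, H i) = ⊤) :
    (∀ i, (Socle (H i)).map (H i).subtype ≤ Socle G) ∧
      (∀ i j, i ≠ j → ∀ x ∈ (Socle (H i)).map (H i).subtype,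
        ∀ y ∈ (Socle (H j)).map (H j).subtype, Commute x y) ∧
      (∀ i, (Socle (H i)).map (H i).subtype ⊓
        (⨆ j, ⨆ (_ : j ≠ i), (Socle (H j)).map (H j).subtype) = ⊥) ∧
      (⨆ i, (Socle (H i)).map (H i).subtype) = Socle G := by
  have hle : ∀ i, (Socle (H i)).map (H i).subtype ≤ H i := fun i =>
    Subgroup.map_subtype_le _
  have hsocle : ∀ i, (Socle (H i)).map (H i).subtype ≤ Socle G := by
    intro i
    rw [Subgroup.map_le_iff_le_comap]
    refine sSup_le fun N hN => ?_
    obtain ⟨hnormal, hsimple⟩ := hN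
    rw [← Subgroup.map_le_iff_le_comap]
    refine le_sSup ⟨normal_of_subgroupOf_normal hCC hsup (Subgroup.map_subtype_le N) ?_, ?_⟩
    · rwa [← Subgroup.comap_subtype, Subgroup.comap_map_eq_self_of_injective
        (Subgroup.subtype_injective _)]
    · exact (N.equivMapOfInjective _ (Subgroup.subtype_injective _)).symm.isSimpleGroup
  refine ⟨hsocle, fun i j hij x hx y hy => hCC i j hij x (hle i hx) y (hle j hy), fun i => ?_,
    le_antisymm (iSup_le hsocle) (sSup_le ?_)⟩
  · exact eq_bot_mono (inf_le_inf (hle i) (iSup₂_mono fun j _ => hle j)) (hMI i)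
  · rintro N ⟨hN, hsimple⟩
    by_cases hex : ∃ i, N ≤ H i
    · obtain ⟨i, hi⟩ := hex
      exact (le_map_socle_of_le hi hN hsimple).trans
        (le_iSup (fun i => (Socle (H i)).map (H i).subtype) i)
    · push Not at hex
      have hcenter : N ≤ Subgroup.center G := by
        refine fun x hx => mem_center_of_forall_commute hsup fun i y hy => ?_
        have hnormal : (H i).Normal :=
          normal_of_subgroupOf_normal hCC hsup le_rfl
            (by rw [Subgroup.subgroupOf_self]; infer_instance)
        refine Subgroup.commute_of_normal_of_disjoint N (H i) hN hnormal ?_ x y hx hy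
        rcases (hnormal.subgroupOf N).eq_bot_or_eq_top with h | h
        · exact (Subgroup.subgroupOf_eq_bot.1 h).symm
        · exact absurd (Subgroup.subgroupOf_eq_top.1 h) (hex i)
      obtain ⟨p, hp, hpow⟩ := exists_prime_pow_eq_one (N := N) fun x y =>
        Subtype.ext (Subgroup.mem_center_iff.1 (hcenter y.2) x)
      exact fun x hx => mem_iSup_map_socle_of_mem_center hCC hMI hsup hp (hcenter hx)
        (congrArg Subtype.val (hpow ⟨x, hx⟩))
end

section
/- Let G be a group and (H i)_{i ∈ ι} a family of subgroups of G such that: for all distinct i, j, every element of H i commutes with every element of H j; for each i, H i ⊓ (⨆_{j ≠ i} H j) = ⊥; and ⨆ i, H i = ⊤. Then for every simple group S, G has a normal subgroup that is simple as a group and isomorphic to S if and only if there exists i ∈ ι such that the group H i has a normal subgroup that is simple as a group and isomorphic to S. -/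
namespace Subgroup

variable {G : Type*} [Group G]

lemma normal_of_iSup_le_normalizer {ι : Type*} {H : ι → Subgroup G} (hsup : (⨆ i, H i) = ⊤)
    {N : Subgroup G} (h : ∀ i, H i ≤ normalizer (N : Set G)) : N.Normal :=
  normalizer_eq_top_iff.1 (top_le_iff.1 (hsup ▸ iSup_le h))

lemma le_normalizer_of_commute {K N : Subgroup G} (h : ∀ x ∈ K, ∀ y ∈ N, Commute x y) :
    K ≤ normalizer (N : Set G) := by
  intro x hx
  rw [mem_normalizer_iff]
  intro y
  constructor
  · intro hy
    rwa [(h x hx y hy).eq, mul_inv_cancel_right]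
  · intro hy
    have := (h x hx _ hy).eq
    have h2 : x * y * x⁻¹ = y := by
      simpa [mul_assoc] using this
    rwa [h2] at hy

/-- The projection of an internal direct product onto a factor along a normal complement. -/
lemma exists_projection_of_isComplement_normal {H K : Subgroup G} [K.Normal] (hd : H ⊓ K = ⊥)
    (hc : H ⊔ K = ⊤) :
    ∃ f : G →* H, Function.Surjective f ∧ f.ker = K := by
  let g : H →* G ⧸ K := (QuotientGroup.mk' K).comp H.subtype
  have hg : Function.Bijective g := by
    constructor
    · rw [injective_iff_map_eq_one]
      rintro ⟨x, hx⟩ h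
      have hk : x ∈ K := by simpa [g] using h
      have : x ∈ H ⊓ K := ⟨hx, hk⟩
      rw [hd, mem_bot] at this
      exact Subtype.ext this
    · intro q
      obtain ⟨x, rfl⟩ := QuotientGroup.mk'_surjective K q
      obtain ⟨h, hh, k, hk, rfl⟩ := mem_sup_of_normal_right.1 (hc ▸ mem_top x : x ∈ H ⊔ K)
      exact ⟨⟨h, hh⟩, by simp [g, hk]⟩
  let e := MulEquiv.ofBijective g hg
  refine ⟨e.symm.toMonoidHom.comp (QuotientGroup.mk' K),
    e.symm.surjective.comp (QuotientGroup.mk'_surjective K), ?_⟩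
  ext x
  simp

lemma eq_one_of_forall_mem_iSup_ne {ι : Type*} {H : ι → Subgroup G} [∀ i, (H i).Normal]
    (hMI : ∀ i, H i ⊓ (⨆ j, ⨆ (_ : j ≠ i), H j) = ⊥) (s : Finset ι) {x : G}
    (hx : x ∈ ⨆ i ∈ s, H i) (h : ∀ i, x ∈ ⨆ j, ⨆ (_ : j ≠ i), H j) : x = 1 := by
  classical
  induction s using Finset.induction_on with
  | empty => simpa using hx
  | insert i s hi ih =>
    rw [Finset.iSup_insert] at hx
    obtain ⟨a, ha, b, hb, rfl⟩ := mem_sup_of_normal_left.1 hx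
    have hbK : b ∈ ⨆ j, ⨆ (_ : j ≠ i), H j := by
      refine (iSup₂_le fun j hj => ?_ : (⨆ j ∈ s, H j) ≤ _) hb
      exact le_iSup₂_of_le j (fun e => hi (e ▸ hj)) le_rfl
    have : a ∈ H i ⊓ (⨆ j, ⨆ (_ : j ≠ i), H j) := ⟨ha, (mul_mem_cancel_right hbK).1 (h i)⟩
    rw [hMI, mem_bot] at this
    exact ih (by simpa [this] using hb)

lemma injective_comp_subtype_or_le_ker {K : Type*} [Group K] (f : G →* K) (N : Subgroup G) [IsSimpleGroup N] :
    Function.Injective (f.comp N.subtype) ∨ N ≤ f.ker := by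
  rcases (f.comp N.subtype).normal_ker.eq_bot_or_eq_top with h | h
  · exact .inl ((MonoidHom.ker_eq_bot_iff _).1 h)
  · refine .inr fun x hx => ?_
    have : (⟨x, hx⟩ : N) ∈ (f.comp N.subtype).ker := h ▸ mem_top _
    exact this

end Subgroup

theorem stmt_15 {G : Type*} [Group G] {ι : Type*} (H : ι → Subgroup G)
    (hCC : ∀ i j, i ≠ j → ∀ x ∈ H i, ∀ y ∈ H j, Commute x y)
    (hMI : ∀ i, H i ⊓ (⨆ j, ⨆ (_ : j ≠ i), H j) = ⊥)
    (hsup : (⨆ i, H i) = ⊤) :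
    ∀ (S : Type*) [Group S] [IsSimpleGroup S],
      (∃ N : Subgroup G, N.Normal ∧ IsSimpleGroup N ∧ Nonempty (N ≃* S)) ↔
        ∃ i, ∃ N : Subgroup (H i), N.Normal ∧ IsSimpleGroup N ∧ Nonempty (N ≃* S) := by
  intro S _ _
  have hnormal (i : ι) : (H i).Normal := by
    refine Subgroup.normal_of_iSup_le_normalizer hsup fun j => ?_
    rcases eq_or_ne j i with rfl | hij
    · exact Subgroup.le_normalizer
    · exact Subgroup.le_normalizer_of_commute (hCC j i hij)
  constructor
  · rintro ⟨N, hN, hs, ⟨e⟩⟩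
    have hproj (i : ι) : ∃ f : G →* H i, Function.Surjective f ∧
        f.ker = ⨆ j, ⨆ (_ : j ≠ i), H j := by
      refine Subgroup.exists_projection_of_isComplement_normal (hMI i) ?_
      rw [← top_le_iff, ← hsup]
      refine iSup_le fun j => ?_
      rcases eq_or_ne j i with rfl | hij
      · exact le_sup_left
      · exact le_sup_of_le_right (le_iSup₂_of_le j hij le_rfl)
    choose f hf hker using hproj
    by_cases h : ∃ i, Function.Injective ((f i).comp N.subtype)
    · obtain ⟨i, hi⟩ := h
      let φ : N ≃* N.map (f i) := MulEquiv.ofBijective ((f i).subgroupMap N)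
        ⟨fun x y hxy => hi (congrArg Subtype.val hxy), (f i).subgroupMap_surjective N⟩
      exact ⟨i, N.map (f i), hN.map _ (hf i), φ.symm.isSimpleGroup, ⟨φ.symm.trans e⟩⟩
    · push Not at h
      obtain ⟨x, hx⟩ := exists_ne (1 : N)
      refine absurd (Subtype.ext ?_) hx
      have hxs : (x : G) ∈ ⨆ s : Finset ι, ⨆ i ∈ s, H i := by
        rw [← iSup_eq_iSup_finset, hsup]
        exact Subgroup.mem_top _
      have hdir : Directed (· ≤ ·) fun s : Finset ι => ⨆ i ∈ s, H i :=
        Monotone.directed_le fun s t hst => biSup_mono fun i hi => Finset.mem_of_subset hst hi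
      obtain ⟨s, hs⟩ := (Subgroup.mem_iSup_of_directed hdir).1 hxs
      exact Subgroup.eq_one_of_forall_mem_iSup_ne hMI s hs fun i =>
        hker i ▸ (Subgroup.injective_comp_subtype_or_le_ker (f i) N).resolve_left (h i) x.2
  · rintro ⟨i, N, hN, hs, ⟨e⟩⟩
    let φ : N ≃* N.map (H i).subtype := N.equivMapOfInjective _ (H i).subtype_injective
    refine ⟨N.map (H i).subtype, ?_, φ.symm.isSimpleGroup, ⟨φ.symm.trans e⟩⟩
    refine Subgroup.normal_of_iSup_le_normalizer hsup fun j => ?_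
    rcases eq_or_ne j i with rfl | hij
    · have := Subgroup.le_normalizer_map (H := N) (H j).subtype
      rwa [Subgroup.normalizer_eq_top_iff.2 hN, ← MonoidHom.range_eq_map,
        Subgroup.range_subtype] at this
    · refine Subgroup.le_normalizer_of_commute fun x hx y hy => hCC j i hij x hx y ?_
      exact Subgroup.map_subtype_le N hy
end

section
/- Let G and G' be semisimple groups, f : G →* G' a normal morphism, and S a simple group. Then f restricts to a map from G_S to G'_S, and this restriction is itself a normal morphism: for every subgroup N of G with N ≤ G_S whose corresponding subgroup of G_S is normal in G_S, one has f(N) ≤ G'_S and the corresponding subgroup of G'_S is normal in G'_S. -/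
/-- A normal subgroup meets a simple subgroup trivially or contains it. -/
theorem disjoint_or_le_of_isSimpleGroup {G : Type*} [Group G] (M K : Subgroup G)
    [IsSimpleGroup M] [K.Normal] : Disjoint M K ∨ M ≤ K := by
  rcases (inferInstance : (K.subgroupOf M).Normal).eq_bot_or_eq_top with h | h
  · exact Or.inl (Subgroup.subgroupOf_eq_bot.mp h).symm
  · exact Or.inr (Subgroup.subgroupOf_eq_top.mp h)

/-- Two normal simple subgroups are disjoint or equal. -/
theorem disjoint_or_eq_of_isSimpleGroup {G : Type*} [Group G] (M K : Subgroup G)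
    [M.Normal] [K.Normal] [IsSimpleGroup M] [IsSimpleGroup K] : Disjoint M K ∨ M = K := by
  rcases disjoint_or_le_of_isSimpleGroup M K with h | h
  · exact Or.inl h
  · rcases disjoint_or_le_of_isSimpleGroup K M with h' | h'
    · exact Or.inl h'.symm
    · exact Or.inr (le_antisymm h h')

/-- A normal simple subgroup lies in the isotypical component or centralizes it. -/
theorem le_isoComponent_or_le_centralizer {G : Type*} [Group G] (S : Type*) [Group S]
    (M : Subgroup G) [M.Normal] [IsSimpleGroup M] :
    M ≤ IsoComponent G S ∨ M ≤ Subgroup.centralizer (IsoComponent G S : Set G) := by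
  by_cases hM : M ≤ IsoComponent G S
  · exact Or.inl hM
  · refine Or.inr (Subgroup.le_centralizer_iff.mp (sSup_le ?_))
    rintro K ⟨hK, hKs, hKS⟩
    rcases disjoint_or_eq_of_isSimpleGroup M K with h | rfl
    · intro k hk m hm
      exact Subgroup.commute_of_normal_of_disjoint M K inferInstance hK h m k hm hk
    · exact (hM (le_sSup ⟨hK, hKs, hKS⟩)).elim

/-- In a semisimple group, normality in an isotypical component implies normality. -/
theorem normal_of_normal_subgroupOf_isoComponent {G : Type*} [Group G] (hG : Socle G = ⊤)
    (S : Type*) [Group S] {N : Subgroup G} (hN : N ≤ IsoComponent G S)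
    (hn : (N.subgroupOf (IsoComponent G S)).Normal) : N.Normal := by
  rw [← Subgroup.normalizer_eq_top_iff, eq_top_iff, ← hG]
  refine sSup_le ?_
  rintro M ⟨hM, hMs⟩
  rcases le_isoComponent_or_le_centralizer S M with h | h
  · exact h.trans ((Subgroup.normal_subgroupOf_iff_le_normalizer hN).mp hn)
  · exact (h.trans (Subgroup.centralizer_le hN)).trans (Subgroup.centralizer_le_normalizer _)

/-- A normal morphism maps isotypical components into isotypical components. -/
theorem map_isoComponent_le {G G' : Type*} [Group G] [Group G'] (f : G →* G')
    (hf : ∀ N : Subgroup G, N.Normal → (N.map f).Normal) (S : Type*) [Group S] :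
    (IsoComponent G S).map f ≤ IsoComponent G' S := by
  refine Subgroup.map_le_iff_le_comap.mpr (sSup_le ?_)
  rintro K ⟨hK, hKs, ⟨e⟩⟩
  rw [← Subgroup.map_le_iff_le_comap]
  rcases disjoint_or_le_of_isSimpleGroup K f.ker with h | h
  · have hinj : Function.Injective (f.subgroupMap K) := by
      rw [injective_iff_map_eq_one]
      rintro ⟨x, hx⟩ h1
      have : x ∈ f.ker := congrArg Subtype.val h1
      exact Subtype.ext (Subgroup.disjoint_def.mp h hx this)
    let e' : K ≃* K.map f :=
      MulEquiv.ofBijective (f.subgroupMap K) ⟨hinj, f.subgroupMap_surjective K⟩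
    exact le_sSup ⟨hf K hK, e'.symm.isSimpleGroup, ⟨e'.symm.trans e⟩⟩
  · rw [(Subgroup.map_eq_bot_iff K).mpr h]
    exact bot_le

theorem stmt_17 {G G' : Type*} [Group G] [Group G']
    (hG : Socle G = ⊤) (hG' : Socle G' = ⊤)
    (f : G →* G') (hf : ∀ N : Subgroup G, N.Normal → (N.map f).Normal)
    (S : Type*) [Group S] [IsSimpleGroup S] :
    (∀ x ∈ IsoComponent G S, f x ∈ IsoComponent G' S) ∧
      ∀ N : Subgroup G, N ≤ IsoComponent G S →
        (N.subgroupOf (IsoComponent G S)).Normal →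
          N.map f ≤ IsoComponent G' S ∧
            ((N.map f).subgroupOf (IsoComponent G' S)).Normal := by
  have hle := map_isoComponent_le f hf S
  refine ⟨fun x hx => hle (Subgroup.mem_map_of_mem f hx), fun N hN hn => ?_⟩
  have := hf N (normal_of_normal_subgroupOf_isoComponent hG S hN hn)
  exact ⟨(Subgroup.map_mono hN).trans hle, inferInstance⟩
end

section
/- Let G and G' be semisimple groups and let (S i)_{i ∈ ι} be a family of simple groups, pairwise non-isomorphic, such that the simple groups isomorphic to some S i are exactly those occurring (up to isomorphism) as simple normal subgroups of both G and G' (i.e. the S i enumerate the intersection of the supports of G and G'). Then the map Φ sending a normal morphism f : G →* G' to the family of its restrictions (the induced normal morphisms from the group G_{S i} to the group G'_{S i}, for i ∈ ι) is a bijection from the set of normal morphisms G →* G' onto the product over i ∈ ι of the sets of normal morphisms from G_{S i} to G'_{S i}. -/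
/-- A group homomorphism is normal if it maps normal subgroups of the source
to normal subgroups of the target. -/
def IsNormalHom {A B : Type*} [Group A] [Group B] (f : A →* B) : Prop :=
  ∀ N : Subgroup A, N.Normal → (N.map f).Normal

namespace Subgroup

variable {A B : Type*} [Group A] [Group B]

theorem map_eq_bot_or_isSimpleGroup (T : Subgroup A) (hT : IsSimpleGroup T) (f : A →* B) :
    T.map f = ⊥ ∨ IsSimpleGroup (T.map f) ∧ Nonempty (T ≃* T.map f) := by
  have hsurj := f.subgroupMap_surjective T
  rcases (MonoidHom.normal_ker (f.subgroupMap T)).eq_bot_or_eq_top with h | h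
  · right
    let e : T ≃* T.map f :=
      MulEquiv.ofBijective (f.subgroupMap T) ⟨(MonoidHom.ker_eq_bot_iff _).1 h, hsurj⟩
    exact ⟨e.symm.isSimpleGroup, ⟨e⟩⟩
  · left
    rw [eq_bot_iff]
    rintro _ ⟨x, hx, rfl⟩
    have : (⟨x, hx⟩ : T) ∈ (f.subgroupMap T).ker := h ▸ mem_top _
    exact congrArg Subtype.val (MonoidHom.mem_ker.1 this)

theorem le_or_disjoint_of_isSimpleGroup {T N : Subgroup A} (hT : IsSimpleGroup T)
    (hN : N.Normal) : T ≤ N ∨ Disjoint T N := by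
  rcases (hN.subgroupOf T).eq_bot_or_eq_top with h | h
  · exact .inr (subgroupOf_eq_bot.1 h).symm
  · exact .inl (subgroupOf_eq_top.1 h)

/-- To show that a subgroup of a semisimple group is everything, it is enough to show that it
contains all simple normal subgroups. -/
theorem eq_top_of_socle (hA : Socle A = ⊤) {K : Subgroup A}
    (h : ∀ T : Subgroup A, T.Normal → IsSimpleGroup T → T ≤ K) : K = ⊤ :=
  top_le_iff.1 (hA ▸ sSup_le fun T hT => h T hT.1 hT.2)

theorem exists_normal_isCompl (hA : Socle A = ⊤) {N : Subgroup A} (hN : N.Normal) :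
    ∃ C : Subgroup A, C.Normal ∧ IsCompl N C := by
  obtain ⟨C, -, ⟨hCn, hCd⟩, hmax⟩ := zorn_le_nonempty₀
    {C : Subgroup A | C.Normal ∧ Disjoint N C} (fun c hc hchain y hy => by
      refine ⟨sSup c, ⟨sSup_normal c fun H hH => (hc hH).1, ?_⟩, fun z hz => le_sSup hz⟩
      rw [disjoint_def]
      intro x hxN hx
      obtain ⟨H, hH, hxH⟩ := (mem_sSup_of_directedOn ⟨y, hy⟩ hchain.directedOn).1 hx
      exact disjoint_def.1 (hc hH).2 hxN hxH) ⊥ ⟨inferInstance, disjoint_bot_right⟩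
  refine ⟨C, hCn, hCd, codisjoint_iff.2 (eq_top_of_socle hA fun T hTn hTs => ?_)⟩
  have hNC : (N ⊔ C).Normal := sup_normal N C
  refine (le_or_disjoint_of_isSimpleGroup hTs hNC).resolve_right fun hd => ?_
  have hTC : T ≤ C := by
    refine le_sup_left.trans (hmax (y := T ⊔ C) ⟨sup_normal T C, ?_⟩ le_sup_right)
    rw [disjoint_def]
    intro x hxN hx
    obtain ⟨t, ht, c, hc, rfl⟩ := mem_sup_of_normal_left.1 hx
    have htNC : t ∈ N ⊔ C := by
      simpa using mul_mem (le_sup_left (b := C) hxN) (inv_mem (le_sup_right (a := N) hc))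
    obtain rfl := disjoint_def.1 hd ht htNC
    rw [one_mul] at hxN ⊢
    exact disjoint_def.1 hCd hxN hc
  have hbot : T = ⊥ := disjoint_self.1 (hd.mono_right (hTC.trans le_sup_right))
  exact T.nontrivial_iff_ne_bot.1 hTs.toNontrivial hbot

theorem exists_retraction (hA : Socle A = ⊤) {N : Subgroup A} (hN : N.Normal) :
    ∃ r : A →* N, ∀ x : N, r x = x := by
  obtain ⟨C, hC, hNC⟩ := exists_normal_isCompl hA hN
  let φ : N →* A ⧸ C := (QuotientGroup.mk' C).comp N.subtype
  have hinj : Function.Injective φ := by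
    refine (injective_iff_map_eq_one φ).2 fun x hx => Subtype.ext ?_
    exact disjoint_def.1 hNC.disjoint x.2 ((QuotientGroup.eq_one_iff _).1 hx)
  have hsurj : Function.Surjective φ := by
    intro y
    obtain ⟨a, rfl⟩ := QuotientGroup.mk'_surjective C y
    obtain ⟨n, hn, c, hc, rfl⟩ := mem_sup_of_normal_left.1
      (hNC.sup_eq_top.symm ▸ mem_top a : a ∈ N ⊔ C)
    refine ⟨⟨n, hn⟩, ?_⟩
    simpa [φ] using (QuotientGroup.eq_one_iff c).2 hc
  let e := MulEquiv.ofBijective φ ⟨hinj, hsurj⟩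
  exact ⟨e.symm.toMonoidHom.comp (QuotientGroup.mk' C), fun x => e.symm_apply_apply x⟩

theorem surjective_of_retraction {K : Subgroup A} {r : A →* K} (hr : ∀ x : K, r x = x) :
    Function.Surjective r := fun x => ⟨x, hr x⟩

theorem Normal.map_subtype_of_retraction {K : Subgroup A} (hK : K.Normal) {r : A →* K}
    (hr : ∀ x : K, r x = x) {M : Subgroup K} (hM : M.Normal) : (M.map K.subtype).Normal := by
  refine ⟨?_⟩
  rintro _ ⟨m, hm, rfl⟩ g
  refine ⟨⟨g * m * g⁻¹, hK.conj_mem _ m.2 g⟩, ?_, rfl⟩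
  have h := hM.conj_mem m hm (r g)
  rw [← hr ⟨g * m * g⁻¹, hK.conj_mem _ m.2 g⟩]
  simpa [hr] using h

theorem exists_mulEquiv_of_le_sSup (hA : Socle A = ⊤) {T : Subgroup A} (hTn : T.Normal)
    (hTs : IsSimpleGroup T) {X : Set (Subgroup A)}
    (hX : ∀ N ∈ X, N.Normal ∧ IsSimpleGroup N) (hle : T ≤ sSup X) :
    ∃ N ∈ X, Nonempty (N ≃* T) := by
  obtain ⟨r, hr⟩ := exists_retraction hA hTn
  by_contra! hne
  have hker : sSup X ≤ r.ker := sSup_le fun N hN => by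
    have := hne N hN
    rw [← map_eq_bot_iff]
    refine (map_eq_bot_or_isSimpleGroup N (hX N hN).2 r).resolve_right ?_
    rintro ⟨hs, ⟨e⟩⟩
    rcases ((hX N hN).1.map r (surjective_of_retraction hr)).eq_bot_or_eq_top with h | h
    · exact nontrivial_iff_ne_bot _ |>.1 hs.toNontrivial h
    · exact this.false (e.trans ((MulEquiv.subgroupCongr h).trans topEquiv))
  obtain ⟨t, ht⟩ := exists_ne (1 : T)
  exact ht ((hr t).symm.trans (hker (hle t.2)))

/-- A retraction onto a normal subgroup `K` either kills a simple normal subgroup or maps it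
isomorphically onto a simple normal subgroup contained in `K`. -/
theorem le_ker_or_exists_mulEquiv {K : Subgroup A} (hK : K.Normal) {r : A →* K}
    (hr : ∀ x : K, r x = x) {T : Subgroup A} (hTn : T.Normal) (hTs : IsSimpleGroup T) :
    T ≤ r.ker ∨ ∃ U : Subgroup A, U.Normal ∧ IsSimpleGroup U ∧ U ≤ K ∧ Nonempty (T ≃* U) := by
  rw [← map_eq_bot_iff]
  refine (map_eq_bot_or_isSimpleGroup T hTs r).imp_right ?_
  rintro ⟨hs, ⟨e⟩⟩
  let e' := (T.map r).equivMapOfInjective K.subtype K.subtype_injective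
  exact ⟨(T.map r).map K.subtype,
    hK.map_subtype_of_retraction hr (hTn.map r (surjective_of_retraction hr)),
    e'.symm.isSimpleGroup, map_subtype_le _, ⟨e.trans e'⟩⟩

/-- A normal subgroup of a semisimple group is generated by simple normal subgroups. -/
theorem Normal.eq_sSup (hA : Socle A = ⊤) {K : Subgroup A} (hK : K.Normal) :
    K = sSup {T : Subgroup A | T.Normal ∧ IsSimpleGroup T ∧ T ≤ K} := by
  refine le_antisymm ?_ (sSup_le fun T hT => hT.2.2)
  obtain ⟨r, hr⟩ := exists_retraction hA hK
  have htop : (sSup {T : Subgroup A | T.Normal ∧ IsSimpleGroup T ∧ T ≤ K}).comap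
      (K.subtype.comp r) = ⊤ := by
    refine eq_top_of_socle hA fun T hTn hTs => ?_
    rw [← map_le_iff_le_comap, ← map_map]
    rcases map_eq_bot_or_isSimpleGroup T hTs r with h | ⟨hs, -⟩
    · simp [h]
    · let e := (T.map r).equivMapOfInjective K.subtype K.subtype_injective
      exact le_sSup ⟨hK.map_subtype_of_retraction hr
        (hTn.map r (surjective_of_retraction hr)), e.symm.isSimpleGroup, map_subtype_le _⟩
  intro x hx
  have : x ∈ (sSup {T : Subgroup A | T.Normal ∧ IsSimpleGroup T ∧ T ≤ K}).comap
      (K.subtype.comp r) := htop ▸ mem_top x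
  simpa [hr ⟨x, hx⟩] using this

theorem Normal.exists_isSimpleGroup_le (hA : Socle A = ⊤) {K : Subgroup A} (hK : K.Normal)
    (hne : K ≠ ⊥) : ∃ T : Subgroup A, T.Normal ∧ IsSimpleGroup T ∧ T ≤ K := by
  by_contra! h
  refine hne ((hK.eq_sSup hA).trans (sSup_eq_bot.2 fun T hT => ?_))
  exact (h T hT.1 hT.2.1 hT.2.2).elim

end Subgroup

section IsoComponent

variable {A B : Type*} [Group A] [Group B]

theorem isNormalHom_of_isSimpleGroup (hA : Socle A = ⊤) {f : A →* B}
    (h : ∀ T : Subgroup A, T.Normal → IsSimpleGroup T → (T.map f).Normal) :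
    IsNormalHom f := by
  intro N hN
  rw [hN.eq_sSup hA, sSup_eq_iSup, Subgroup.map_iSup]
  simp only [Subgroup.map_iSup]
  exact Subgroup.biSup_normal _ _ fun T hT => h T hT.1 hT.2.1

theorem isoComponent_normal (A S : Type*) [Group A] [Group S] : (IsoComponent A S).Normal :=
  Subgroup.sSup_normal _ fun _ hT => hT.1

theorem nonempty_mulEquiv_of_le_isoComponent {S : Type*} [Group S] (hA : Socle A = ⊤)
    {T : Subgroup A} (hTn : T.Normal) (hTs : IsSimpleGroup T) (hle : T ≤ IsoComponent A S) :
    Nonempty (T ≃* S) := by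
  obtain ⟨N, ⟨-, -, ⟨e⟩⟩, ⟨e'⟩⟩ := Subgroup.exists_mulEquiv_of_le_sSup hA hTn hTs
    (fun N hN => ⟨hN.1, hN.2.1⟩) hle
  exact ⟨e'.symm.trans e⟩

theorem le_ker_of_isEmpty_mulEquiv {S : Type*} [Group S] (hA : Socle A = ⊤)
    {r : A →* IsoComponent A S} (hr : ∀ x : IsoComponent A S, r x = x)
    {T : Subgroup A} (hTn : T.Normal) (hTs : IsSimpleGroup T) (hTS : IsEmpty (T ≃* S)) :
    T ≤ r.ker := by
  refine (Subgroup.le_ker_or_exists_mulEquiv (isoComponent_normal A S) hr hTn hTs).resolve_right ?_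
  rintro ⟨U, hUn, hUs, hle, ⟨e⟩⟩
  obtain ⟨e'⟩ := nonempty_mulEquiv_of_le_isoComponent hA hUn hUs hle
  exact hTS.false (e.trans e')

theorem isoComponent_le_ker {S S' : Type*} [Group S] [Group S'] (hA : Socle A = ⊤)
    {r : A →* IsoComponent A S} (hr : ∀ x : IsoComponent A S, r x = x)
    (hSS' : IsEmpty (S' ≃* S)) : IsoComponent A S' ≤ r.ker :=
  sSup_le fun _ ⟨hTn, hTs, ⟨e⟩⟩ =>
    le_ker_of_isEmpty_mulEquiv hA hr hTn hTs ⟨fun e' => hSS'.false (e.symm.trans e')⟩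

theorem IsNormalHom.map_isoComponent_le {f : A →* B} (hf : IsNormalHom f) (S : Type*) [Group S] :
    (IsoComponent A S).map f ≤ IsoComponent B S := by
  rw [Subgroup.map_le_iff_le_comap]
  refine sSup_le fun T ⟨hTn, hTs, ⟨e⟩⟩ => ?_
  rw [← Subgroup.map_le_iff_le_comap]
  rcases Subgroup.map_eq_bot_or_isSimpleGroup T hTs f with h | ⟨hs, ⟨e'⟩⟩
  · simp [h]
  · exact le_sSup ⟨hf T hTn, hs, ⟨e'.symm.trans e⟩⟩

/-- The restriction of a normal morphism to isotypical components. -/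
def IsNormalHom.restrict {f : A →* B} (hf : IsNormalHom f) (S : Type*) [Group S] :
    IsoComponent A S →* IsoComponent B S :=
  (f.comp (IsoComponent A S).subtype).codRestrict (IsoComponent B S)
    fun x => hf.map_isoComponent_le S (Subgroup.mem_map_of_mem f x.2)

theorem IsNormalHom.isNormalHom_restrict {f : A →* B} (hf : IsNormalHom f) (hA : Socle A = ⊤)
    (S : Type*) [Group S] : IsNormalHom (hf.restrict S) := by
  intro K hK
  obtain ⟨r, hr⟩ := Subgroup.exists_retraction hA (isoComponent_normal A S)
  have h := hf _ ((isoComponent_normal A S).map_subtype_of_retraction hr hK)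
  have hmap : K.map (hf.restrict S) =
      ((K.map (IsoComponent A S).subtype).map f).subgroupOf (IsoComponent B S) := by
    rw [Subgroup.map_map, ← Subgroup.comap_subtype]
    have : f.comp (IsoComponent A S).subtype =
      (IsoComponent B S).subtype.comp (hf.restrict S) := rfl
    rw [this, ← Subgroup.map_map,
      Subgroup.comap_map_eq_self_of_injective (Subgroup.subtype_injective _)]
  rw [hmap]
  exact h.subgroupOf _

theorem IsNormalHom.map_eq_bot {f : A →* B} (hf : IsNormalHom f) {T : Subgroup A}
    (hTn : T.Normal) (hTs : IsSimpleGroup T)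
    (h : ¬ ∃ M : Subgroup B, M.Normal ∧ IsSimpleGroup M ∧ Nonempty (T ≃* M)) :
    T.map f = ⊥ :=
  (Subgroup.map_eq_bot_or_isSimpleGroup T hTs f).resolve_right
    fun ⟨hs, he⟩ => h ⟨_, hf T hTn, hs, he⟩

/-- Morphisms between isotypical components of semisimple groups glue to a morphism that kills
all other simple normal subgroups. -/
theorem exists_monoidHom_extending (hA : Socle A = ⊤) (hB : Socle B = ⊤)
    {ι : Type*} (S : ι → Type*) [∀ i, Group (S i)]
    (hS : ∀ i j, i ≠ j → IsEmpty (S i ≃* S j))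
    (g : ∀ i, IsoComponent A (S i) →* IsoComponent B (S i)) :
    ∃ f : A →* B, (∀ i (x : IsoComponent A (S i)), f x = g i x) ∧
      ∀ T : Subgroup A, T.Normal → IsSimpleGroup T → (∀ i, IsEmpty (T ≃* S i)) →
        T ≤ f.ker := by
  choose r hr using fun i => Subgroup.exists_retraction hA (isoComponent_normal A (S i))
  choose q hq using fun i => Subgroup.exists_retraction hB (isoComponent_normal B (S i))
  let R : A →* ∀ i, IsoComponent B (S i) := MonoidHom.pi fun i => (g i).comp (r i)
  let Q : B →* ∀ i, IsoComponent B (S i) := MonoidHom.pi q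
  let D : Subgroup B := ⨆ i, IsoComponent B (S i)
  have hDle (i) : IsoComponent B (S i) ≤ D := le_iSup (fun i => IsoComponent B (S i)) i
  have hDn : D.Normal :=
    have := fun i => isoComponent_normal B (S i)
    Subgroup.iSup_normal _
  have hDiso {T : Subgroup B} (hTn : T.Normal) (hTs : IsSimpleGroup T) (hle : T ≤ D) :
      ∃ i, T ≤ IsoComponent B (S i) := by
    let X : Set (Subgroup B) := ⋃ i, {N | N.Normal ∧ IsSimpleGroup N ∧ Nonempty (N ≃* S i)}
    have hX : sSup X = D := by simp only [X, sSup_iUnion]; rfl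
    obtain ⟨N, hN, ⟨e⟩⟩ := Subgroup.exists_mulEquiv_of_le_sSup hB hTn hTs (X := X)
      (fun N hN => by
        obtain ⟨i, hi⟩ := Set.mem_iUnion.1 hN
        exact ⟨hi.1, hi.2.1⟩) (hX ▸ hle)
    obtain ⟨i, -, -, ⟨e'⟩⟩ := Set.mem_iUnion.1 hN
    exact ⟨i, le_sSup ⟨hTn, hTs, ⟨e.symm.trans e'⟩⟩⟩
  have hQD : Disjoint D Q.ker := by
    rw [disjoint_iff]
    by_contra hne
    have : (D ⊓ Q.ker).Normal := Subgroup.normal_inf_normal _ _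
    obtain ⟨T, hTn, hTs, hle⟩ := this.exists_isSimpleGroup_le hB hne
    obtain ⟨i, hi⟩ := hDiso hTn hTs (hle.trans inf_le_left)
    obtain ⟨t, ht⟩ := exists_ne (1 : T)
    have h1 : q i t = 1 := congrFun (MonoidHom.mem_ker.1 (hle t.2).2) i
    have h2 : q i t = ⟨t, hi t.2⟩ := hq i ⟨t, hi t.2⟩
    have h3 : (t : B) = 1 := congrArg Subtype.val (h2.symm.trans h1)
    exact ht (Subtype.ext h3)
  have hinj : Function.Injective (Q.comp D.subtype) := by
    refine (injective_iff_map_eq_one _).2 fun x hx => Subtype.ext ?_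
    exact Subgroup.disjoint_def.1 hQD x.2 hx
  have hcompat (i) (x : IsoComponent A (S i)) : Q (g i x) = R x := by
    funext j
    change q j (g i x) = g j (r j x)
    by_cases hij : i = j
    · subst hij
      rw [hq, hr]
    · have h1 : q j (g i x) = 1 := isoComponent_le_ker hB (hq j) (hS i j hij) (g i x).2
      have h2 : r j x = 1 := isoComponent_le_ker hA (hr j) (hS i j hij) x.2
      rw [h1, h2, map_one]
  have hRker {T : Subgroup A} (hTn : T.Normal) (hTs : IsSimpleGroup T)
      (hT : ∀ i, IsEmpty (T ≃* S i)) : T ≤ R.ker := by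
    intro t ht
    refine funext fun i => ?_
    have h : r i t = 1 := le_ker_of_isEmpty_mulEquiv hA (hr i) hTn hTs (hT i) ht
    change g i (r i t) = 1
    rw [h, map_one]
  have hrange (x : A) : R x ∈ (Q.comp D.subtype).range := by
    have htop : (Q.comp D.subtype).range.comap R = ⊤ := by
      refine Subgroup.eq_top_of_socle hA fun T hTn hTs t ht => ?_
      by_cases hT : ∀ i, IsEmpty (T ≃* S i)
      · have : R t = 1 := hRker hTn hTs hT ht
        rw [Subgroup.mem_comap, this]
        exact one_mem _
      · simp only [not_forall, not_isEmpty_iff] at hT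
        obtain ⟨i, hi⟩ := hT
        have hle : T ≤ IsoComponent A (S i) := le_sSup ⟨hTn, hTs, hi⟩
        exact ⟨⟨g i ⟨t, hle ht⟩, hDle i (g i ⟨t, hle ht⟩).2⟩, hcompat i ⟨t, hle ht⟩⟩
    exact (htop ▸ Subgroup.mem_top x : x ∈ (Q.comp D.subtype).range.comap R)
  let e := MonoidHom.ofInjective hinj
  let F : A →* D := e.symm.toMonoidHom.comp (R.codRestrict _ hrange)
  have hF (x : A) : Q (F x) = R x :=
    congrArg Subtype.val (e.apply_symm_apply (R.codRestrict _ hrange x))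
  refine ⟨D.subtype.comp F, fun i x => ?_, fun T hTn hTs hT t ht => ?_⟩
  · have : F x = ⟨g i x, hDle i (g i x).2⟩ := hinj ((hF x).trans (hcompat i x).symm)
    exact congrArg Subtype.val this
  · have : F t = 1 := hinj ((hF t).trans ((hRker hTn hTs hT ht).trans (map_one _).symm))
    exact congrArg Subtype.val this

end IsoComponent

theorem stmt_18 {G G' : Type*} [Group G] [Group G']
    (hG : Socle G = ⊤) (hG' : Socle G' = ⊤)
    {ι : Type*} (S : ι → Type*) [∀ i, Group (S i)]
    (hSsimple : ∀ i, IsSimpleGroup (S i))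
    (hSiso : ∀ i j, i ≠ j → IsEmpty (S i ≃* S j))
    (hboth : ∀ i, (∃ N : Subgroup G, N.Normal ∧ IsSimpleGroup N ∧ Nonempty (N ≃* S i)) ∧
      (∃ N : Subgroup G', N.Normal ∧ IsSimpleGroup N ∧ Nonempty (N ≃* S i)))
    (hcover : ∀ N : Subgroup G, N.Normal → IsSimpleGroup N →
      (∃ M : Subgroup G', M.Normal ∧ IsSimpleGroup M ∧ Nonempty (N ≃* M)) →
      ∃ i, Nonempty (N ≃* S i)) :
    ∃ Φ : {f : G →* G' // IsNormalHom f} →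
        (∀ i, {g : IsoComponent G (S i) →* IsoComponent G' (S i) // IsNormalHom g}),
      Function.Bijective Φ ∧
        ∀ (f : {f : G →* G' // IsNormalHom f}) (i : ι) (x : IsoComponent G (S i)),
          ((Φ f i).1 x : G') = f.1 x := by
  refine ⟨fun f i => ⟨f.2.restrict (S i), f.2.isNormalHom_restrict hG (S i)⟩, ⟨?_, ?_⟩,
    fun f i x => rfl⟩
  · intro f f' hff'
    have hres (i : ι) (x : IsoComponent G (S i)) : f.1 x = f'.1 x :=
      congrArg Subtype.val (DFunLike.congr_fun (congrArg Subtype.val (congrFun hff' i)) x)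
    refine Subtype.ext (MonoidHom.eq_of_eqOn_top ?_)
    have htop : f.1.eqLocus f'.1 = ⊤ := by
      refine Subgroup.eq_top_of_socle hG fun T hTn hTs t ht => ?_
      by_cases hM : ∃ M : Subgroup G', M.Normal ∧ IsSimpleGroup M ∧ Nonempty (T ≃* M)
      · obtain ⟨i, hi⟩ := hcover T hTn hTs hM
        have hle : T ≤ IsoComponent G (S i) := le_sSup ⟨hTn, hTs, hi⟩
        exact hres i ⟨t, hle ht⟩
      · have h := (Subgroup.map_eq_bot_iff _).1 (f.2.map_eq_bot hTn hTs hM) ht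
        have h' := (Subgroup.map_eq_bot_iff _).1 (f'.2.map_eq_bot hTn hTs hM) ht
        exact (MonoidHom.mem_ker.1 h).trans (MonoidHom.mem_ker.1 h').symm
    exact fun x _ => (htop ▸ Subgroup.mem_top x : x ∈ f.1.eqLocus f'.1)
  · intro g
    obtain ⟨f, hfg, hker⟩ := exists_monoidHom_extending hG hG' S hSiso fun i => (g i).1
    have hf : IsNormalHom f := by
      refine isNormalHom_of_isSimpleGroup hG fun T hTn hTs => ?_
      by_cases hT : ∀ i, IsEmpty (T ≃* S i)
      · rw [(Subgroup.map_eq_bot_iff _).2 (hker T hTn hTs hT)]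
        infer_instance
      · simp only [not_forall, not_isEmpty_iff] at hT
        obtain ⟨i, hi⟩ := hT
        have hle : T ≤ IsoComponent G (S i) := le_sSup ⟨hTn, hTs, hi⟩
        obtain ⟨q, hq⟩ := Subgroup.exists_retraction hG' (isoComponent_normal G' (S i))
        have hcomp : f.comp (IsoComponent G (S i)).subtype =
            (IsoComponent G' (S i)).subtype.comp (g i).1 := MonoidHom.ext (hfg i)
        rw [← Subgroup.map_subgroupOf_eq_of_le hle, Subgroup.map_map, hcomp, ← Subgroup.map_map]
        exact (isoComponent_normal G' (S i)).map_subtype_of_retraction hq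
          ((g i).2 _ (hTn.subgroupOf _))
    refine ⟨⟨f, hf⟩, funext fun i => Subtype.ext (MonoidHom.ext fun x => Subtype.ext ?_)⟩
    exact hfg i x
end
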